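/- arXiv:1501.00464 — 7 statements merged into one kernel-verified Lean document; each statement's English description precedes it below -/
import Mathlib

section
/- Let f_1, ..., f_m be polynomials with real coefficients, all of the same degree n and all with positive leading coefficient. Then the following are equivalent: (1) the family {f_1, ..., f_m} is nice; (2) every convex combination Σ_k t_k f_k (t_k ≥ 0, Σ_k t_k = 1) has only real roots. Moreover, if these equivalent conditions hold, then for every convex combination f = Σ_k t_k f_k and every j = 1, ..., n, one has min_i ρ_j(f_i) ≤ ρ_j(f) ≤ max_i ρ_j(f_i). -/
open Polynomial

/-- The `j`-th largest real root (counted with multiplicity) of a real polynomial,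
indexed from `j = 1`; defaults to `0` if there are fewer than `j` roots. -/
noncomputable def rho (f : Polynomial ℝ) (j : ℕ) : ℝ :=
  ((f.roots.sort (· ≤ ·)).reverse).getD (j - 1) 0

/-- A family `f : Fin m → ℝ[X]` of degree-`n` polynomials with positive leading
coefficients is *nice* if every member has all roots real and for every
`j = 2, …, n` one has `max_i ρ_j(f i) ≤ min_i ρ_{j-1}(f i)`. -/
def IsNice (m n : ℕ) (f : Fin m → Polynomial ℝ) : Prop :=
  (∀ i, (f i).roots.card = n) ∧
  ∀ j : ℕ, 2 ≤ j → j ≤ n → ∀ i i' : Fin m, rho (f i) j ≤ rho (f i') (j - 1)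

open Filter Topology

/-- The number of real roots of `f`, with multiplicity, that exceed `x`. -/
noncomputable def rootsAbove (f : ℝ[X]) (x : ℝ) : ℕ :=
  f.roots.countP (x < ·)

/-- `f` has degree `n`, positive leading coefficient and only real roots. -/
structure RealRooted (n : ℕ) (f : ℝ[X]) : Prop where
  natDegree_le : f.natDegree ≤ n
  coeff_pos : 0 < f.coeff n
  card_roots : f.roots.card = n

namespace RealRooted

variable {n : ℕ} {f g : ℝ[X]}

theorem ne_zero (hf : RealRooted n f) : f ≠ 0 := by
  rintro rfl
  simpa using hf.coeff_pos

theorem natDegree_eq (hf : RealRooted n f) : f.natDegree = n :=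
  le_antisymm hf.natDegree_le (le_natDegree_of_ne_zero hf.coeff_pos.ne')

theorem leadingCoeff_pos (hf : RealRooted n f) : 0 < f.leadingCoeff := by
  rw [leadingCoeff, hf.natDegree_eq]
  exact hf.coeff_pos

theorem splits (hf : RealRooted n f) : f.Splits :=
  splits_iff_card_roots.2 (hf.card_roots.trans hf.natDegree_eq.symm)

theorem derivative (hf : RealRooted (n + 1) f) : RealRooted n (derivative f) where
  natDegree_le := (natDegree_derivative_le f).trans (by have := hf.natDegree_le; omega)
  coeff_pos := by
    rw [coeff_derivative]
    have := hf.coeff_pos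
    positivity
  card_roots := by
    have h₁ := card_roots_le_derivative f
    have h₂ := card_roots' (Polynomial.derivative f)
    have h₃ := natDegree_derivative_le f
    have h₄ := hf.natDegree_le
    have h₅ := hf.card_roots
    omega

/-- The sign of `f` at a point that is not a root is the parity of the number of larger roots. -/
theorem sign_eval (hf : RealRooted n f) {x : ℝ} (hx : f.eval x ≠ 0) :
    0 < (-1) ^ rootsAbove f x * f.eval x := by
  have key : ∀ s : Multiset ℝ, x ∉ s →
      0 < (-1) ^ s.countP (x < ·) * (s.map fun a => x - a).prod := by
    intro s
    induction s using Multiset.induction_on with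
    | empty => simp
    | cons a s ih =>
      intro h
      rw [Multiset.mem_cons, not_or] at h
      have := ih h.2
      rw [Multiset.map_cons, Multiset.prod_cons]
      rcases lt_or_gt_of_ne h.1 with hxa | hxa
      · rw [Multiset.countP_cons_of_pos _ hxa, pow_succ]
        nlinarith [mul_pos this (sub_pos.2 hxa)]
      · rw [Multiset.countP_cons_of_neg _ hxa.not_gt]
        nlinarith [mul_pos this (sub_pos.2 hxa)]
  have h := key f.roots fun h => hx ((mem_roots hf.ne_zero).1 h)
  rw [rootsAbove, hf.splits.eval_eq_prod_roots]
  nlinarith [mul_pos hf.leadingCoeff_pos h]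

theorem rootsAbove_mod_two (hf : RealRooted n f) {m : ℕ} (hg : RealRooted m g) {x : ℝ}
    (h : 0 < f.eval x * g.eval x) : rootsAbove f x % 2 = rootsAbove g x % 2 := by
  have hf0 := hf.sign_eval (left_ne_zero_of_mul h.ne')
  have hg0 := hg.sign_eval (right_ne_zero_of_mul h.ne')
  have hpos := mul_pos (mul_pos hf0 hg0) h
  rcases Nat.even_or_odd (rootsAbove f x) with h₁ | h₁ <;>
    rcases Nat.even_or_odd (rootsAbove g x) with h₂ | h₂
  · rw [Nat.even_iff.1 h₁, Nat.even_iff.1 h₂]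
  · rw [h₁.neg_one_pow, h₂.neg_one_pow] at *
    nlinarith
  · rw [h₁.neg_one_pow, h₂.neg_one_pow] at *
    nlinarith
  · rw [Nat.odd_iff.1 h₁, Nat.odd_iff.1 h₂]

theorem rootsAbove_mod_two_ne (hf : RealRooted n f) {m : ℕ} (hg : RealRooted m g) {x : ℝ}
    (h : f.eval x * g.eval x < 0) : rootsAbove f x % 2 ≠ rootsAbove g x % 2 := by
  have hf0 := hf.sign_eval (left_ne_zero_of_mul h.ne)
  have hg0 := hg.sign_eval (right_ne_zero_of_mul h.ne)
  intro heq
  rcases Nat.even_or_odd (rootsAbove f x) with h₁ | h₁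
  · have h₂ : Even (rootsAbove g x) := Nat.even_iff.2 (heq ▸ Nat.even_iff.1 h₁)
    rw [h₁.neg_one_pow] at hf0
    rw [h₂.neg_one_pow] at hg0
    nlinarith
  · have h₂ : Odd (rootsAbove g x) := Nat.odd_iff.2 (heq ▸ Nat.odd_iff.1 h₁)
    rw [h₁.neg_one_pow] at hf0
    rw [h₂.neg_one_pow] at hg0
    nlinarith

end RealRooted

/-- Rolle's theorem with multiplicities, for the roots in an order-connected set. -/
theorem countP_roots_le_derivative (f : ℝ[X]) (p : ℝ → Prop) [DecidablePred p]
    (hp : ∀ x y z, p x → p y → x < z → z < y → p z) :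
    f.roots.countP p ≤ (derivative f).roots.countP p + 1 := by
  rcases eq_or_ne (derivative f) 0 with hf' | hf'
  · rw [eq_C_of_derivative_eq_zero hf']
    simp
  have hf : f ≠ 0 := ne_of_apply_ne derivative (by rwa [derivative_zero])
  have hsum : ∀ s : Multiset ℝ, s.countP p = ∑ x ∈ s.toFinset with p x, s.count x := by
    intro s
    rw [Multiset.countP_eq_card_filter, ← Multiset.toFinset_sum_count_eq, Multiset.toFinset_filter]
    refine Finset.sum_congr rfl fun x hx => ?_
    rw [Multiset.count_filter_of_pos (Finset.mem_filter.1 hx).2]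
  set S := f.roots.toFinset.filter p with hS
  set T := (derivative f).roots.toFinset.filter p with hT
  have hinter : S.card ≤ (T \ S).card + 1 := by
    refine Finset.card_le_sdiff_of_interleaved fun x hx y hy hxy _ => ?_
    rw [hS, Finset.mem_filter, Multiset.mem_toFinset, mem_roots hf] at hx hy
    obtain ⟨z, hz1, hz2⟩ := exists_deriv_eq_zero hxy f.continuousOn (hx.1.trans hy.1.symm)
    refine ⟨z, ?_, hz1⟩
    rw [hT, Finset.mem_filter, Multiset.mem_toFinset, mem_roots hf', IsRoot, ← f.deriv]
    exact ⟨hz2, hp x y z hx.2 hy.2 hz1.1 hz1.2⟩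
  have h₁ : f.roots.countP p ≤ ∑ x ∈ S, (derivative f).roots.count x + S.card := by
    rw [hsum, Finset.card_eq_sum_ones, ← Finset.sum_add_distrib]
    refine Finset.sum_le_sum fun x _ => ?_
    have := rootMultiplicity_sub_one_le_derivative_rootMultiplicity f x
    rw [count_roots, count_roots]
    omega
  have h₂ : (T \ S).card ≤ ∑ x ∈ T \ S, (derivative f).roots.count x := by
    rw [Finset.card_eq_sum_ones]
    refine Finset.sum_le_sum fun x hx => ?_
    have := (Finset.mem_filter.1 (Finset.mem_sdiff.1 hx).1).1
    exact Multiset.one_le_count_iff_mem.2 (Multiset.mem_toFinset.1 this)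
  have h₃ : ∑ x ∈ S, (derivative f).roots.count x + ∑ x ∈ T \ S, (derivative f).roots.count x
      = (derivative f).roots.countP p := by
    rw [hsum, ← Finset.sum_union Finset.disjoint_sdiff, Finset.union_sdiff_self_eq_union]
    symm
    refine Finset.sum_subset Finset.subset_union_right fun x hx hxT => ?_
    have hpx : p x := by
      rcases Finset.mem_union.1 hx with h | h <;> exact (Finset.mem_filter.1 h).2
    rw [Multiset.count_eq_zero]
    intro h
    exact hxT (Finset.mem_filter.2 ⟨Multiset.mem_toFinset.2 h, hpx⟩)
  omega

namespace RealRooted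

variable {n : ℕ} {f g : ℝ[X]}

theorem rootsAbove_le_derivative (f : ℝ[X]) (x : ℝ) :
    rootsAbove f x ≤ rootsAbove (Polynomial.derivative f) x + 1 :=
  countP_roots_le_derivative f _ fun _ _ _ ha _ hac _ => ha.trans hac

theorem rootsAbove_derivative_le (hf : RealRooted (n + 1) f) (x : ℝ) :
    rootsAbove (Polynomial.derivative f) x ≤ rootsAbove f x := by
  have h := countP_roots_le_derivative f (fun y => ¬ x < y)
    fun _ _ _ _ hb _ hcb h => hb (h.trans hcb)
  have h₁ := Multiset.card_eq_countP_add_countP (x < ·) f.roots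
  have h₂ := Multiset.card_eq_countP_add_countP (x < ·) (Polynomial.derivative f).roots
  rw [hf.card_roots] at h₁
  rw [hf.derivative.card_roots] at h₂
  unfold rootsAbove
  omega

theorem rootsAbove_le_card (hf : RealRooted n f) (x : ℝ) : rootsAbove f x ≤ n :=
  (Multiset.countP_le_card _ _).trans hf.card_roots.le

/-- Counting roots above a point is continuous from the right. -/
theorem eventually_rootsAbove_right (f : ℝ[X]) (x : ℝ) :
    ∀ᶠ y in 𝓝[>] x, rootsAbove f y = rootsAbove f x := by
  have h : ∀ᶠ y in 𝓝[>] x, ∀ r ∈ f.roots.toFinset, (y < r ↔ x < r) := by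
    rw [Finset.eventually_all]
    intro r _
    rcases lt_or_ge x r with hr | hr
    · filter_upwards [Ioo_mem_nhdsGT hr] with y hy
      exact iff_of_true hy.2 hr
    · filter_upwards [self_mem_nhdsWithin] with y hy
      exact iff_of_false (hr.trans (le_of_lt hy)).not_gt hr.not_gt
  filter_upwards [h] with y hy
  exact Multiset.countP_congr rfl fun r hr => by simpa using hy r (Multiset.mem_toFinset.2 hr)

theorem eventually_rootsAbove {x : ℝ} (hx : f.eval x ≠ 0) :
    ∀ᶠ y in 𝓝 x, rootsAbove f y = rootsAbove f x := by
  have h : ∀ᶠ y in 𝓝 x, ∀ r ∈ f.roots.toFinset, (y < r ↔ x < r) := by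
    rw [Finset.eventually_all]
    intro r hr
    have hne : x ≠ r := by
      rintro rfl
      exact hx (isRoot_of_mem_roots (Multiset.mem_toFinset.1 hr))
    rcases lt_or_gt_of_ne hne with hr | hr
    · filter_upwards [eventually_lt_nhds hr] with y hy
      exact iff_of_true hy hr
    · filter_upwards [eventually_gt_nhds hr] with y hy
      exact iff_of_false hy.not_gt hr.not_gt
  filter_upwards [h] with y hy
  exact Multiset.countP_congr rfl fun r hr => by simpa using hy r (Multiset.mem_toFinset.2 hr)

theorem eventually_eval_ne_zero (hf : f ≠ 0) (x : ℝ) : ∀ᶠ y in 𝓝[>] x, f.eval y ≠ 0 := by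
  have h : ∀ᶠ y in 𝓝[>] x, ∀ r ∈ f.roots.toFinset, y ≠ r := by
    rw [Finset.eventually_all]
    intro r _
    rcases lt_or_ge x r with hr | hr
    · filter_upwards [Ioo_mem_nhdsGT hr] with y hy
      exact hy.2.ne
    · filter_upwards [self_mem_nhdsWithin] with y hy
      exact (hr.trans_lt hy).ne'
  filter_upwards [h] with y hy h0
  exact hy y (Multiset.mem_toFinset.2 ((mem_roots hf).2 h0)) rfl

/-- The logarithmic derivative strictly decreases on an interval free of roots. -/
theorem logDeriv_lt (hf : RealRooted (n + 1) f) {x y : ℝ} (hxy : x < y)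
    (h : ∀ z ∈ Set.Icc x y, f.eval z ≠ 0) :
    (Polynomial.derivative f).eval y / f.eval y < (Polynomial.derivative f).eval x / f.eval x := by
  rw [hf.splits.eval_derivative_div_eval_of_ne_zero (h y ⟨hxy.le, le_rfl⟩),
    hf.splits.eval_derivative_div_eval_of_ne_zero (h x ⟨le_rfl, hxy.le⟩)]
  refine Multiset.sum_lt_sum_of_nonempty ?_ fun r hr => ?_
  · refine Multiset.card_pos.1 ?_
    rw [hf.card_roots]
    omega
  have hr0 : f.eval r = 0 := isRoot_of_mem_roots hr
  rcases lt_or_ge r x with hrx | hrx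
  · exact one_div_lt_one_div_of_lt (sub_pos.2 hrx) (by linarith)
  · have hry : y < r := by
      by_contra hle
      exact h r ⟨hrx, not_lt.1 hle⟩ hr0
    exact one_div_lt_one_div_of_neg_of_lt (by linarith) (by linarith)

end RealRooted

/-- Every nontrivial nonnegative combination of `f` and `g` has degree `n`, positive leading
coefficient and only real roots. -/
def RealRootedCone (n : ℕ) (f g : ℝ[X]) : Prop :=
  ∀ a b : ℝ, 0 ≤ a → 0 ≤ b → 0 < a + b → RealRooted n (C a * f + C b * g)

namespace RealRootedCone

variable {n : ℕ} {f g : ℝ[X]}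

theorem left (h : RealRootedCone n f g) : RealRooted n f := by
  simpa using h 1 0 zero_le_one le_rfl (by norm_num)

theorem symm (h : RealRootedCone n f g) : RealRootedCone n g f := fun a b ha hb hab => by
  rw [add_comm]
  exact h b a hb ha (by linarith)

theorem right (h : RealRootedCone n f g) : RealRooted n g :=
  h.symm.left

theorem derivative (h : RealRootedCone (n + 1) f g) :
    RealRootedCone n (derivative f) (derivative g) := fun a b ha hb hab => by
  simpa using (h a b ha hb hab).derivative

theorem combination (h : RealRootedCone n f g) {a b : ℝ} (ha : 0 ≤ a) (hb : 0 ≤ b)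
    (hab : 0 < a + b) : RealRootedCone n f (C a * f + C b * g) := fun c d hc hd hcd => by
  have hpos : 0 < (c + d * a) + d * b := by
    rcases hd.eq_or_lt with rfl | hd
    · linarith
    · nlinarith [mul_pos hd hab]
  convert h (c + d * a) (d * b) (by positivity) (by positivity) hpos using 1
  simp only [C_add, C_mul]
  ring

/-- The root counts of two polynomials with a real-rooted cone differ by at most one away from
their roots. -/
def CountsClose (n : ℕ) : Prop :=
  ∀ f g : ℝ[X], RealRootedCone n f g → ∀ x, f.eval x ≠ 0 → g.eval x ≠ 0 →
    rootsAbove f x ≤ rootsAbove g x + 1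

theorem rootsAbove_eq_of_derivative (hn : CountsClose n) (h : RealRootedCone (n + 1) f g) {x : ℝ}
    (h0 : 0 < f.eval x * g.eval x)
    (h1 : 0 < (Polynomial.derivative f).eval x * (Polynomial.derivative g).eval x) :
    rootsAbove f x = rootsAbove g x := by
  have hf' := left_ne_zero_of_mul h1.ne'
  have hg' := right_ne_zero_of_mul h1.ne'
  have c₁ := hn _ _ h.derivative x hf' hg'
  have c₂ := hn _ _ h.derivative.symm x hg' hf'
  have c₃ := h.derivative.left.rootsAbove_mod_two h.derivative.right h1
  have c₄ := h.left.rootsAbove_mod_two h.right h0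
  have c₅ := RealRooted.rootsAbove_le_derivative f x
  have c₆ := RealRooted.rootsAbove_le_derivative g x
  have c₇ := h.left.rootsAbove_derivative_le x
  have c₈ := h.right.rootsAbove_derivative_le x
  omega

theorem rootsAbove_eq_of_derivative_eq_zero (hn : CountsClose n)
    (h : RealRootedCone (n + 1) f g) {x : ℝ} (h0 : 0 < f.eval x * g.eval x)
    (hf' : (Polynomial.derivative f).eval x ≠ 0) (hg' : (Polynomial.derivative g).eval x = 0) :
    rootsAbove f x = rootsAbove g x := by
  have hf0 := left_ne_zero_of_mul h0.ne'
  have hg0 := right_ne_zero_of_mul h0.ne'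
  have hpos : ∀ᶠ y in 𝓝 x, 0 < f.eval y * g.eval y :=
    (f.continuous.mul g.continuous).continuousAt.eventually (eventually_gt_nhds h0)
  have hnear := hpos.and ((RealRooted.eventually_rootsAbove hf0).and
    (RealRooted.eventually_rootsAbove hg0))
  have hcont : ContinuousAt (fun y => (Polynomial.derivative f).eval y * f.eval y) x :=
    ((Polynomial.derivative f).continuous.mul f.continuous).continuousAt
  have finish : ∀ y, (0 < f.eval y * g.eval y ∧ rootsAbove f y = rootsAbove f x ∧
      rootsAbove g y = rootsAbove g x) →
      0 < ((Polynomial.derivative f).eval y * f.eval y) *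
        ((Polynomial.derivative g).eval y / g.eval y) →
      rootsAbove f x = rootsAbove g x := by
    rintro y ⟨hy0, hyf, hyg⟩ hy1
    rw [← hyf, ← hyg]
    refine rootsAbove_eq_of_derivative hn h hy0 ?_
    have hg : g.eval y ≠ 0 := right_ne_zero_of_mul hy0.ne'
    have hg2 : 0 < g.eval y ^ 2 := by positivity
    have hy2 := mul_pos hy1 hg2
    have : (Polynomial.derivative f).eval y * f.eval y *
        ((Polynomial.derivative g).eval y / g.eval y) * g.eval y ^ 2 =
        ((Polynomial.derivative f).eval y * (Polynomial.derivative g).eval y) *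
          (f.eval y * g.eval y) := by
      field_simp
    rw [this] at hy2
    exact pos_of_mul_pos_left hy2 hy0.le
  have hg_zero : (Polynomial.derivative g).eval x / g.eval x = 0 := by rw [hg', zero_div]
  rcases lt_or_gt_of_ne (mul_ne_zero hf' hf0) with hs | hs
  · obtain ⟨ε, hε, hball⟩ := Metric.eventually_nhds_iff.1
      (hnear.and (hcont.eventually (eventually_lt_nhds hs)))
    have hin : ∀ z ∈ Set.Icc x (x + ε / 2), dist z x < ε := fun z hz => by
      rw [Real.dist_eq, abs_lt]
      constructor <;> linarith [hz.1, hz.2]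
    have hlog := h.right.logDeriv_lt (show x < x + ε / 2 by linarith)
      fun z hz => right_ne_zero_of_mul (hball (hin z hz)).1.1.ne'
    have hb := hball (hin (x + ε / 2) ⟨by linarith, le_rfl⟩)
    rw [hg_zero] at hlog
    exact finish _ hb.1 (mul_pos_of_neg_of_neg hb.2 hlog)
  · obtain ⟨ε, hε, hball⟩ := Metric.eventually_nhds_iff.1
      (hnear.and (hcont.eventually (eventually_gt_nhds hs)))
    have hin : ∀ z ∈ Set.Icc (x - ε / 2) x, dist z x < ε := fun z hz => by
      rw [Real.dist_eq, abs_lt]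
      constructor <;> linarith [hz.1, hz.2]
    have hlog := h.right.logDeriv_lt (show x - ε / 2 < x by linarith)
      fun z hz => right_ne_zero_of_mul (hball (hin z hz)).1.1.ne'
    have hb := hball (hin (x - ε / 2) ⟨le_rfl, by linarith⟩)
    rw [hg_zero] at hlog
    exact finish _ hb.1 (mul_pos hb.2 hlog)

theorem countsClose (n : ℕ) : CountsClose n := by
  induction n with
  | zero =>
    intro f g h x _ _
    have := h.left.rootsAbove_le_card x
    omega
  | succ n ih =>
    intro f g h
    suffices H : ∀ x, f.eval x ≠ 0 → g.eval x ≠ 0 → (Polynomial.derivative f).eval x ≠ 0 →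
        (Polynomial.derivative g).eval x ≠ 0 → rootsAbove f x ≤ rootsAbove g x + 1 by
      intro x _ _
      obtain ⟨y, hyf, hyg, h₁, h₂, h₃, h₄⟩ := ((RealRooted.eventually_rootsAbove_right f x).and <|
        (RealRooted.eventually_rootsAbove_right g x).and <|
        (RealRooted.eventually_eval_ne_zero h.left.ne_zero x).and <|
        (RealRooted.eventually_eval_ne_zero h.right.ne_zero x).and <|
        (RealRooted.eventually_eval_ne_zero h.left.derivative.ne_zero x).and
        (RealRooted.eventually_eval_ne_zero h.right.derivative.ne_zero x)).exists
      rw [← hyf, ← hyg]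
      exact H y h₁ h₂ h₃ h₄
    intro x hf hg hf' hg'
    rcases lt_or_gt_of_ne (mul_ne_zero hf hg) with h0 | h0
    · have c₁ := ih _ _ h.derivative x hf' hg'
      have c₄ := h.left.rootsAbove_mod_two_ne h.right h0
      have c₅ := RealRooted.rootsAbove_le_derivative f x
      have c₈ := h.right.rootsAbove_derivative_le x
      omega
    · rcases lt_or_gt_of_ne (mul_ne_zero hf' hg') with h1 | h1
      · set u := (Polynomial.derivative f).eval x
        set v := (Polynomial.derivative g).eval x
        have hu : 0 < |u| := abs_pos.2 hf'
        have hv : 0 < |v| := abs_pos.2 hg'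
        have hzero : (Polynomial.derivative (C |v| * f + C |u| * g)).eval x = 0 := by
          simp only [derivative_add, derivative_C_mul, eval_add, eval_mul, eval_C]
          change |v| * u + |u| * v = 0
          rcases mul_neg_iff.1 h1 with ⟨h₁, h₂⟩ | ⟨h₁, h₂⟩
          · rw [abs_of_pos h₁, abs_of_neg h₂]
            ring
          · rw [abs_of_neg h₁, abs_of_pos h₂]
            ring
        have e₁ := rootsAbove_eq_of_derivative_eq_zero ih
          (h.combination hv.le hu.le (by positivity)) (x := x) (by
            simp only [eval_add, eval_mul, eval_C]
            nlinarith [mul_pos hv (pow_pos (abs_pos.2 hf) 2), sq_abs (f.eval x), mul_pos hu h0])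
          hf' hzero
        have e₂ := rootsAbove_eq_of_derivative_eq_zero ih
          (h.symm.combination hu.le hv.le (by positivity)) (x := x) (by
            simp only [eval_add, eval_mul, eval_C]
            nlinarith [mul_pos hu (pow_pos (abs_pos.2 hg) 2), sq_abs (g.eval x), mul_pos hv h0])
          hg' (by rwa [add_comm])
        rw [add_comm, ← e₁] at e₂
        omega
      · exact (rootsAbove_eq_of_derivative ih h h0 h1).le.trans (Nat.le_succ _)

/-- The root counts of two polynomials with a real-rooted cone differ by at most one. -/
theorem rootsAbove_le (h : RealRootedCone n f g) (x : ℝ) :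
    rootsAbove f x ≤ rootsAbove g x + 1 := by
  obtain ⟨y, hyf, hyg, h₁, h₂⟩ := ((RealRooted.eventually_rootsAbove_right f x).and <|
    (RealRooted.eventually_rootsAbove_right g x).and <|
    (RealRooted.eventually_eval_ne_zero h.left.ne_zero x).and
    (RealRooted.eventually_eval_ne_zero h.right.ne_zero x)).exists
  rw [← hyf, ← hyg]
  exact countsClose n f g h y h₁ h₂

end RealRootedCone

theorem lt_getD_iff_le_countP (x : ℝ) (l : List ℝ) (hl : l.Pairwise (· ≥ ·)) (j : ℕ)
    (hj : j < l.length) : x < l.getD j 0 ↔ j + 1 ≤ l.countP (x < ·) := by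
  induction l generalizing j with
  | nil => simp at hj
  | cons a l ih =>
    rw [List.pairwise_cons] at hl
    by_cases ha : x < a
    · rw [List.countP_cons_of_pos (by simpa using ha)]
      cases j with
      | zero => simpa using ha
      | succ j =>
        rw [List.getD_cons_succ, ih hl.2 j (by simpa using hj)]
        omega
    · have hzero : (a :: l).countP (x < ·) = 0 := by
        rw [List.countP_eq_zero]
        intro b hb
        rcases List.mem_cons.1 hb with rfl | hb
        · simpa using ha
        · simpa using (hl.1 b hb).trans (not_lt.1 ha)
      rw [hzero]
      refine iff_of_false (fun h => ?_) (by omega)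
      rw [List.getD_eq_getElem _ _ hj] at h
      have hmem := List.getElem_mem hj
      rw [List.countP_eq_zero] at hzero
      exact hzero _ hmem (by simpa using h)

theorem lt_rho_iff {n : ℕ} {f : ℝ[X]} (hf : f.roots.card = n) {j : ℕ} (hj : 1 ≤ j) (hjn : j ≤ n)
    (x : ℝ) : x < rho f j ↔ j ≤ rootsAbove f x := by
  have hl : (f.roots.sort (· ≤ ·)).reverse.Pairwise (· ≥ ·) := by
    rw [List.pairwise_reverse]
    exact Multiset.pairwise_sort _ _
  rw [rho, lt_getD_iff_le_countP x _ hl (j - 1) (by simp [hf]; omega), List.countP_reverse,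
    ← Multiset.coe_countP, Multiset.sort_eq, Nat.sub_add_cancel hj]
  rfl

theorem rho_le_rho {n : ℕ} {f : ℝ[X]} (hf : f.roots.card = n) {j k : ℕ} (hj : 1 ≤ j) (hjk : j ≤ k)
    (hk : k ≤ n) : rho f k ≤ rho f j := by
  by_contra h
  rw [not_le, lt_rho_iff hf (hj.trans hjk) hk] at h
  exact lt_irrefl _ ((lt_rho_iff hf hj (hjk.trans hk) _).2 (hjk.trans h))

/-- Counting form of the root-interlacing condition. -/
theorem rho_le_rho_pred_iff {n : ℕ} {f g : ℝ[X]} (hf : f.roots.card = n) (hg : g.roots.card = n) :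
    (∀ j, 2 ≤ j → j ≤ n → rho f j ≤ rho g (j - 1)) ↔
      ∀ x, rootsAbove f x ≤ rootsAbove g x + 1 := by
  constructor
  · intro h x
    by_contra hlt
    have hle : rootsAbove f x ≤ n := (Multiset.countP_le_card _ _).trans hf.le
    have h₁ := h (rootsAbove g x + 2) (by omega) (by omega)
    have h₂ := (lt_rho_iff hf (by omega) (by omega) x).2
      (show rootsAbove g x + 2 ≤ rootsAbove f x by omega)
    have h₃ := (lt_rho_iff hg (by omega) (by omega) x).1 (h₂.trans_le h₁)
    omega
  · intro h j hj hjn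
    by_contra hlt
    rw [not_le, lt_rho_iff hf (by omega) hjn] at hlt
    have h₁ := h (rho g (j - 1))
    exact lt_irrefl _ ((lt_rho_iff hg (j := j - 1) (by omega) (by omega) _).2 (by omega))

namespace RealRooted

variable {n : ℕ} {f g : ℝ[X]}

theorem of_leadingCoeff (hdeg : f.natDegree = n) (hlead : 0 < f.leadingCoeff)
    (hcard : f.roots.card = n) : RealRooted n f :=
  ⟨hdeg.le, by rwa [← hdeg], hcard⟩

theorem X_sub_C_mul_iff {a : ℝ} : RealRooted (n + 1) ((X - C a) * g) ↔ RealRooted n g := by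
  have hX := X_sub_C_ne_zero a
  have hlc : ((X - C a) * g).leadingCoeff = g.leadingCoeff := by
    rw [leadingCoeff_mul, leadingCoeff_X_sub_C, one_mul]
  constructor
  · intro h
    have hg : g ≠ 0 := right_ne_zero_of_mul h.ne_zero
    have h₁ := h.natDegree_eq
    have h₂ := h.card_roots
    rw [natDegree_mul hX hg, natDegree_X_sub_C] at h₁
    rw [roots_mul h.ne_zero, roots_X_sub_C, Multiset.card_add, Multiset.card_singleton] at h₂
    exact of_leadingCoeff (by omega) (hlc ▸ h.leadingCoeff_pos) (by omega)
  · intro h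
    have hg := h.ne_zero
    refine of_leadingCoeff ?_ (hlc ▸ h.leadingCoeff_pos) ?_
    · rw [natDegree_mul hX hg, natDegree_X_sub_C, h.natDegree_eq, add_comm]
    · rw [roots_mul (mul_ne_zero hX hg), roots_X_sub_C, Multiset.card_add, h.card_roots,
        Multiset.card_singleton, add_comm]

theorem _root_.rootsAbove_X_sub_C_mul (a x : ℝ) (hg : g ≠ 0) :
    rootsAbove ((X - C a) * g) x = (if x < a then 1 else 0) + rootsAbove g x := by
  rw [rootsAbove, roots_mul (mul_ne_zero (X_sub_C_ne_zero a) hg), roots_X_sub_C,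
    Multiset.countP_add, rootsAbove, ← Multiset.cons_zero, Multiset.countP_cons,
    Multiset.countP_zero, zero_add]

theorem sign_eval_nonneg (hf : RealRooted n f) {x : ℝ} {j : ℕ} (h₁ : rootsAbove f x ≤ j)
    (h₂ : ∀ y < x, j ≤ rootsAbove f y) : 0 ≤ (-1) ^ j * f.eval x := by
  by_cases hx : f.eval x = 0
  · simp [hx]
  obtain ⟨ε, hε, hball⟩ := Metric.eventually_nhds_iff.1 (eventually_rootsAbove hx)
  have hy := hball (y := x - ε / 2) (by rw [Real.dist_eq, abs_lt]; constructor <;> linarith)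
  have := h₂ (x - ε / 2) (by linarith)
  rw [show j = rootsAbove f x by omega]
  exact (hf.sign_eval hx).le

end RealRooted

section Combination

variable {ι : Type*} {s : Finset ι} {t : ι → ℝ} {n : ℕ} {f : ι → ℝ[X]}

theorem natDegree_combination_le (hdeg : ∀ i ∈ s, (f i).natDegree ≤ n) :
    (∑ i ∈ s, t i • f i).natDegree ≤ n :=
  natDegree_sum_le_of_forall_le _ _ fun i hi => (natDegree_smul_le _ _).trans (hdeg i hi)

theorem coeff_combination_pos (hs : s.Nonempty) (ht : ∀ i ∈ s, 0 < t i)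
    (hcoeff : ∀ i ∈ s, 0 < (f i).coeff n) : 0 < (∑ i ∈ s, t i • f i).coeff n := by
  simp only [finsetSum_coeff, coeff_smul, smul_eq_mul]
  exact Finset.sum_pos (fun i hi => mul_pos (ht i hi) (hcoeff i hi)) hs

/-- The `j`-th roots of the members lie in disjoint intervals, each containing a root of the
combination. -/
theorem realRooted_combination_of_no_common_root (hs : s.Nonempty) (ht : ∀ i ∈ s, 0 < t i)
    (hf : ∀ i ∈ s, RealRooted n (f i))
    (hclose : ∀ i ∈ s, ∀ i' ∈ s, ∀ x, rootsAbove (f i) x ≤ rootsAbove (f i') x + 1)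
    (hno : ∀ x, ∃ i ∈ s, (f i).eval x ≠ 0) :
    RealRooted n (∑ i ∈ s, t i • f i) ∧ ∀ x k,
      ((∀ i ∈ s, k ≤ rootsAbove (f i) x) → k ≤ rootsAbove (∑ i ∈ s, t i • f i) x) ∧
      ((∀ i ∈ s, rootsAbove (f i) x ≤ k) → rootsAbove (∑ i ∈ s, t i • f i) x ≤ k) := by
  set F := ∑ i ∈ s, t i • f i with hF
  have hdegF : F.natDegree ≤ n := natDegree_combination_le fun i hi => (hf i hi).natDegree_le
  have hcoeffF : 0 < F.coeff n := coeff_combination_pos hs ht fun i hi => (hf i hi).coeff_pos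
  have hF0 : F ≠ 0 := by
    intro h
    simp [h] at hcoeffF
  have hcard : ∀ i ∈ s, (f i).roots.card = n := fun i hi => (hf i hi).card_roots
  let lo : ℕ → ℝ := fun j => s.inf' hs fun i => rho (f i) j
  let hi : ℕ → ℝ := fun j => s.sup' hs fun i => rho (f i) j
  have lo_le : ∀ j, ∀ i ∈ s, lo j ≤ rho (f i) j := fun j i h =>
    Finset.inf'_le (fun i => rho (f i) j) h
  have le_hi : ∀ j, ∀ i ∈ s, rho (f i) j ≤ hi j := fun j i h =>
    Finset.le_sup' (fun i => rho (f i) j) h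
  have hi_le_lo : ∀ j k, 1 ≤ j → j < k → k ≤ n → hi k ≤ lo j := by
    intro j k hj hjk hk
    refine Finset.sup'_le _ _ fun i h => Finset.le_inf' _ _ fun i' h' => ?_
    exact ((rho_le_rho_pred_iff (hcard i h) (hcard i' h')).2 (hclose i h i' h') k (by omega)
      hk).trans (rho_le_rho (hcard i' h') hj (by omega) (by omega))
  have strict : ∀ j x, (∀ i ∈ s, 0 ≤ (-1) ^ j * (f i).eval x) → 0 < (-1) ^ j * F.eval x := by
    intro j x h
    obtain ⟨i, his, hi0⟩ := hno x
    have : (-1) ^ j * F.eval x = ∑ i ∈ s, t i * ((-1) ^ j * (f i).eval x) := by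
      simp only [hF, eval_finsetSum, eval_smul, smul_eq_mul, Finset.mul_sum]
      exact Finset.sum_congr rfl fun i _ => by ring
    rw [this]
    refine Finset.sum_pos' (fun i his => mul_nonneg (ht i his).le (h i his)) ⟨i, his, ?_⟩
    exact mul_pos (ht i his) ((h i his).lt_of_ne' (mul_ne_zero (by simp) hi0))
  have root : ∀ j, ∃ r, 1 ≤ j → j ≤ n → r ∈ Set.Ioo (lo j) (hi j) ∧ F.eval r = 0 := by
    intro j
    by_cases hj : 1 ≤ j ∧ j ≤ n
    swap
    · exact ⟨0, fun h₁ h₂ => absurd ⟨h₁, h₂⟩ hj⟩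
    obtain ⟨hj, hjn⟩ := hj
    have hlo : 0 < (-1) ^ j * F.eval (lo j) := by
      refine strict j _ fun i his => (hf i his).sign_eval_nonneg ?_ fun y hy => ?_
      · by_contra hlt
        have hle := (hf i his).rootsAbove_le_card (lo j)
        have := (lt_rho_iff (hcard i his) (j := j + 1) (by omega) (by omega) (lo j)).2 (by omega)
        exact (this.trans_le (le_hi _ i his)).not_ge (hi_le_lo j (j + 1) hj (by omega) (by omega))
      · exact (lt_rho_iff (hcard i his) hj hjn y).1 (hy.trans_le (lo_le j i his))
    have hhi : 0 < (-1) ^ (j - 1) * F.eval (hi j) := by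
      refine strict (j - 1) _ fun i his => (hf i his).sign_eval_nonneg ?_ fun y hy => ?_
      · by_contra hlt
        have := (lt_rho_iff (hcard i his) hj hjn (hi j)).2 (by omega)
        exact this.not_ge (le_hi j i his)
      · rcases Nat.lt_or_ge j 2 with h | h
        · omega
        · refine (lt_rho_iff (hcard i his) (by omega) (by omega) y).1 (hy.trans_le ?_)
          exact (hi_le_lo (j - 1) j (by omega) (by omega) hjn).trans (lo_le _ i his)
    have hhi' : (-1) ^ j * F.eval (hi j) < 0 := by
      rw [show j = j - 1 + 1 by omega, pow_succ, show j - 1 + 1 = j by omega]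
      linarith
    have hle : lo j ≤ hi j := by
      obtain ⟨i, his⟩ := hs
      exact (lo_le j i his).trans (le_hi j i his)
    obtain ⟨r, hr, hr0⟩ := intermediate_value_Ioo' hle
      (f := fun y => (-1) ^ j * F.eval y) (by fun_prop) ⟨hhi', hlo⟩
    refine ⟨r, fun _ _ => ⟨hr, ?_⟩⟩
    exact (mul_eq_zero.1 hr0).resolve_left (by simp)
  choose r hr using root
  have r_anti : ∀ j k, 1 ≤ j → j < k → k ≤ n → r k < r j := by
    intro j k hj hjk hk
    have h₁ := (hr k (by omega) hk).1.2
    have h₂ := (hr j hj (by omega)).1.1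
    exact h₁.trans_le ((hi_le_lo j k hj hjk hk).trans h₂.le)
  have r_inj : Set.InjOn r (Finset.Icc 1 n : Finset ℕ) := by
    intro j hj k hk hjk
    rw [Finset.mem_coe, Finset.mem_Icc] at hj hk
    rcases lt_trichotomy j k with h | h | h
    · exact absurd hjk (r_anti j k hj.1 h hk.2).ne'
    · exact h
    · exact absurd hjk (r_anti k j hk.1 h hj.2).ne
  have hroots : (Finset.Icc 1 n).val.map r = F.roots := by
    refine Multiset.eq_of_le_of_card_le ?_ ?_
    · rw [Multiset.le_iff_subset ((Finset.Icc 1 n).nodup.map_on fun j hj k hk => r_inj hj hk)]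
      intro y hy
      obtain ⟨j, hj, rfl⟩ := Multiset.mem_map.1 hy
      have hj := Finset.mem_Icc.1 (Finset.mem_def.2 hj)
      exact (mem_roots hF0).2 (hr j hj.1 hj.2).2
    · rw [Multiset.card_map]
      refine (card_roots' F).trans (hdegF.trans ?_)
      simp
  have hcount : ∀ x, rootsAbove F x = ((Finset.Icc 1 n).filter fun j => x < r j).card := by
    intro x
    rw [rootsAbove, ← hroots, Multiset.countP_map]
    rfl
  refine ⟨⟨hdegF, hcoeffF, by rw [← hroots]; simp⟩, fun x k => ⟨fun h => ?_, fun h => ?_⟩⟩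
  · obtain ⟨i₀, hi₀⟩ := hs
    have hkn : k ≤ n := (h i₀ hi₀).trans ((hf i₀ hi₀).rootsAbove_le_card x)
    rw [hcount]
    calc k = (Finset.Icc 1 k).card := by simp
      _ ≤ _ := Finset.card_le_card fun j hj => ?_
    rw [Finset.mem_Icc] at hj
    rw [Finset.mem_filter, Finset.mem_Icc]
    refine ⟨⟨hj.1, hj.2.trans hkn⟩, lt_trans ?_ (hr j hj.1 (hj.2.trans hkn)).1.1⟩
    exact (Finset.lt_inf'_iff _).2 fun i his =>
      (lt_rho_iff (hcard i his) hj.1 (hj.2.trans hkn) x).2 (hj.2.trans (h i his))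
  · rw [hcount]
    calc _ ≤ (Finset.Icc 1 k).card := Finset.card_le_card fun j hj => ?_
      _ = k := by simp
    rw [Finset.mem_filter, Finset.mem_Icc] at hj
    rw [Finset.mem_Icc]
    refine ⟨hj.1.1, ?_⟩
    have hlt := hj.2.trans (hr j hj.1.1 hj.1.2).1.2
    obtain ⟨i, his, hlt⟩ := (Finset.lt_sup'_iff _).1 hlt
    exact ((lt_rho_iff (hcard i his) hj.1.1 hj.1.2 x).1 hlt).trans (h i his)

/-- If the root counts of real-rooted polynomials pairwise differ by at most one, a positive
combination is real-rooted and its root counts lie between the extreme ones. -/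
theorem realRooted_combination (hs : s.Nonempty) (ht : ∀ i ∈ s, 0 < t i)
    (hf : ∀ i ∈ s, RealRooted n (f i))
    (hclose : ∀ i ∈ s, ∀ i' ∈ s, ∀ x, rootsAbove (f i) x ≤ rootsAbove (f i') x + 1) :
    RealRooted n (∑ i ∈ s, t i • f i) ∧ ∀ x k,
      ((∀ i ∈ s, k ≤ rootsAbove (f i) x) → k ≤ rootsAbove (∑ i ∈ s, t i • f i) x) ∧
      ((∀ i ∈ s, rootsAbove (f i) x ≤ k) → rootsAbove (∑ i ∈ s, t i • f i) x ≤ k) := by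
  induction n generalizing f with
  | zero =>
    refine realRooted_combination_of_no_common_root hs ht hf hclose fun x => ?_
    obtain ⟨i, hi⟩ := hs
    refine ⟨i, hi, fun h => ?_⟩
    have := (mem_roots (hf i hi).ne_zero).2 h
    rw [Multiset.card_eq_zero.1 (hf i hi).card_roots] at this
    exact absurd this (Multiset.notMem_zero x)
  | succ n ih =>
    by_cases hno : ∀ x, ∃ i ∈ s, (f i).eval x ≠ 0
    · exact realRooted_combination_of_no_common_root hs ht hf hclose hno
    push Not at hno
    obtain ⟨a, ha⟩ := hno
    set g : ι → ℝ[X] := fun i => f i /ₘ (X - C a)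
    have hfg : ∀ i ∈ s, f i = (X - C a) * g i := fun i hi =>
      (mul_divByMonic_eq_iff_isRoot.2 (ha i hi)).symm
    have hg : ∀ i ∈ s, RealRooted n (g i) := fun i hi =>
      RealRooted.X_sub_C_mul_iff.1 (hfg i hi ▸ hf i hi)
    have hcount : ∀ i ∈ s, ∀ x,
        rootsAbove (f i) x = (if x < a then 1 else 0) + rootsAbove (g i) x := fun i hi x => by
      rw [hfg i hi, rootsAbove_X_sub_C_mul a x (hg i hi).ne_zero]
    obtain ⟨hG, hG'⟩ := ih hg fun i hi i' hi' x => by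
      have := hclose i hi i' hi' x
      rw [hcount i hi, hcount i' hi'] at this
      omega
    have hsum : ∑ i ∈ s, t i • f i = (X - C a) * ∑ i ∈ s, t i • g i := by
      rw [Finset.mul_sum]
      exact Finset.sum_congr rfl fun i hi => by rw [hfg i hi, mul_smul_comm]
    rw [hsum]
    refine ⟨RealRooted.X_sub_C_mul_iff.2 hG, fun x k => ?_⟩
    rw [rootsAbove_X_sub_C_mul a x hG.ne_zero]
    have h := hG' x (k - if x < a then 1 else 0)
    refine ⟨fun hk => ?_, fun hk => ?_⟩
    · have := h.1 fun i hi => by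
        have := hk i hi
        rw [hcount i hi] at this
        omega
      omega
    · have hle : (if x < a then 1 else 0) ≤ k := by
        obtain ⟨i, hi⟩ := hs
        have := hk i hi
        rw [hcount i hi] at this
        omega
      have := h.2 fun i hi => by
        have := hk i hi
        rw [hcount i hi] at this
        omega
      omega

end Combination

theorem IsNice.realRooted_combination {m n : ℕ} {f : Fin m → ℝ[X]} (h : IsNice m n f)
    (hdeg : ∀ i, (f i).natDegree = n) (hlead : ∀ i, 0 < (f i).leadingCoeff) {t : Fin m → ℝ}
    (ht : ∀ i, 0 ≤ t i) (hsum : ∑ i, t i = 1) :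
    RealRooted n (∑ i, t i • f i) ∧ ∀ x k,
      ((∀ i, k ≤ rootsAbove (f i) x) → k ≤ rootsAbove (∑ i, t i • f i) x) ∧
      ((∀ i, rootsAbove (f i) x ≤ k) → rootsAbove (∑ i, t i • f i) x ≤ k) := by
  set s := Finset.univ.filter fun i => 0 < t i with hs
  have hrestrict : ∑ i, t i • f i = ∑ i ∈ s, t i • f i := by
    refine (Finset.sum_filter_of_ne fun i _ hi => (ht i).lt_of_ne' ?_).symm
    exact left_ne_zero_of_smul hi
  have hne : s.Nonempty := by
    obtain ⟨i, hi, hpos⟩ := Finset.exists_lt_of_sum_lt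
      (show ∑ _i : Fin m, (0 : ℝ) < ∑ i, t i by simp [hsum])
    exact ⟨i, Finset.mem_filter.2 ⟨hi, hpos⟩⟩
  obtain ⟨hF, hF'⟩ := _root_.realRooted_combination (f := f) hne
    (fun i hi => (Finset.mem_filter.1 hi).2)
    (fun i _ => RealRooted.of_leadingCoeff (hdeg i) (hlead i) (h.1 i))
    (fun i _ i' _ => (rho_le_rho_pred_iff (h.1 i) (h.1 i')).1 fun j hj hjn => h.2 j hj hjn i i')
  rw [hrestrict]
  exact ⟨hF, fun x k => ⟨fun hk => (hF' x k).1 fun i _ => hk i,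
    fun hk => (hF' x k).2 fun i _ => hk i⟩⟩

theorem realRootedCone_of_convex {m n : ℕ} {f : Fin m → ℝ[X]} (hdeg : ∀ i, (f i).natDegree = n)
    (hlead : ∀ i, 0 < (f i).leadingCoeff)
    (h : ∀ t : Fin m → ℝ, (∀ i, 0 ≤ t i) → (∑ i, t i) = 1 →
      (∑ i, t i • f i).roots.card = (∑ i, t i • f i).natDegree) (i i' : Fin m) :
    RealRootedCone n (f i) (f i') := by
  intro a b ha hb hab
  have hcoeff : ∀ i, 0 < (f i).coeff n := fun i => hdeg i ▸ hlead i
  set t : Fin m → ℝ := fun k =>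
    (if k = i then a / (a + b) else 0) + (if k = i' then b / (a + b) else 0) with ht
  have ht0 : ∀ k, 0 ≤ t k := fun k => by
    simp only [ht]
    split_ifs <;> positivity
  have ht1 : ∑ k, t k = 1 := by
    simp only [ht, Finset.sum_add_distrib, Finset.sum_ite_eq', Finset.mem_univ, if_true]
    field_simp
  have hsum : C a * f i + C b * f i' = C (a + b) * ∑ k, t k • f k := by
    simp only [ht, add_smul, ite_smul, zero_smul, Finset.sum_add_distrib, Finset.sum_ite_eq',
      Finset.mem_univ, if_true, smul_eq_C_mul, mul_add, ← mul_assoc, ← C_mul]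
    rw [mul_div_cancel₀ _ hab.ne', mul_div_cancel₀ _ hab.ne']
  have hpos : 0 < (C a * f i + C b * f i').coeff n := by
    rw [coeff_add, coeff_C_mul, coeff_C_mul]
    rcases ha.eq_or_lt with rfl | ha
    · have := mul_pos (show 0 < b by linarith) (hcoeff i')
      linarith
    · have := mul_pos ha (hcoeff i)
      have := mul_nonneg hb (hcoeff i').le
      linarith
  have hle : (C a * f i + C b * f i').natDegree ≤ n :=
    natDegree_add_le_of_degree_le ((natDegree_C_mul_le _ _).trans (hdeg i).le)
      ((natDegree_C_mul_le _ _).trans (hdeg i').le)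
  refine ⟨hle, hpos, ?_⟩
  rw [← le_antisymm hle (le_natDegree_of_ne_zero hpos.ne'), hsum, roots_C_mul _ hab.ne',
    natDegree_C_mul hab.ne']
  exact h t ht0 ht1

/-- Characterization of nice families: a family of degree-`n` real polynomials with
positive leading coefficients is nice iff every convex combination has only real
roots; moreover in that case, for any convex combination `f = ∑ tₖ fₖ` and every
`j = 1, …, n`, one has `min_i ρ_j(f i) ≤ ρ_j(f) ≤ max_i ρ_j(f i)`. -/
theorem nice_family_iff (m n : ℕ) (hm : 0 < m) (f : Fin m → Polynomial ℝ)
    (hdeg : ∀ i, (f i).natDegree = n)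
    (hlead : ∀ i, 0 < (f i).leadingCoeff) :
    (IsNice m n f ↔
      ∀ t : Fin m → ℝ, (∀ i, 0 ≤ t i) → (∑ i, t i) = 1 →
        (∑ i, t i • f i).roots.card = (∑ i, t i • f i).natDegree) ∧
    (IsNice m n f →
      ∀ t : Fin m → ℝ, (∀ i, 0 ≤ t i) → (∑ i, t i) = 1 →
        ∀ j : ℕ, 1 ≤ j → j ≤ n →
          (∃ i, rho (f i) j ≤ rho (∑ i, t i • f i) j) ∧
          (∃ i, rho (∑ i, t i • f i) j ≤ rho (f i) j)) := by
  refine ⟨⟨fun h t ht hsum => ?_, fun h => ?_⟩, fun h t ht hsum j hj hjn => ?_⟩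
  · have hF := (h.realRooted_combination hdeg hlead ht hsum).1
    rw [hF.card_roots, hF.natDegree_eq]
  · have hcone := realRootedCone_of_convex hdeg hlead h
    refine ⟨fun i => (hcone i i).left.card_roots, fun j hj hjn i i' => ?_⟩
    exact (rho_le_rho_pred_iff (hcone i i').left.card_roots (hcone i i').right.card_roots).2
      (hcone i i').rootsAbove_le j hj hjn
  · obtain ⟨hF, hcount⟩ := h.realRooted_combination hdeg hlead ht hsum
    constructor
    · by_contra! hlt
      have := (hcount (rho (∑ i, t i • f i) j) j).1 fun i =>
        (lt_rho_iff (h.1 i) hj hjn _).1 (hlt i)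
      exact lt_irrefl _ ((lt_rho_iff hF.card_roots hj hjn _).2 this)
    · by_contra! hlt
      have : Nonempty (Fin m) := ⟨⟨0, hm⟩⟩
      obtain ⟨i₀, hi₀⟩ := Finite.exists_max fun i => rho (f i) j
      have hle := (hcount (rho (f i₀) j) (j - 1)).2 fun i => by
        by_contra hgt
        exact (hi₀ i).not_gt ((lt_rho_iff (h.1 i) hj hjn _).2 (by omega))
      have := (lt_rho_iff hF.card_roots hj hjn _).1 (hlt i₀)
      omega
end

section
/- Let A_1, ..., A_m ∈ M_d(ℂ) be positive semidefinite Hermitian matrices. Then the polynomial q(z, z_1, ..., z_m) = det(z·I_d + Σ_{i=1}^m z_i A_i) in m+1 variables is real stable. -/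
open MvPolynomial
open scoped ComplexOrder

/-- A polynomial in `k` complex variables is *real stable* if all its coefficients are
real and it has no zeros in `ℍ^k`, where `ℍ` is the open upper half-plane. -/
def RealStable {k : ℕ} (p : MvPolynomial (Fin k) ℂ) : Prop :=
  (∀ c : Fin k →₀ ℕ, ∃ r : ℝ, MvPolynomial.coeff c p = (r : ℂ)) ∧
  ∀ w : Fin k → ℂ, (∀ i, 0 < (w i).im) → MvPolynomial.eval w p ≠ 0

/-- A polynomial fixed by coefficientwise complex conjugation has real coefficients. -/
theorem exists_real_coeff_of_map_conj_eq_self {σ : Type*} {p : MvPolynomial σ ℂ}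
    (hp : MvPolynomial.map (starRingEnd ℂ) p = p) (c : σ →₀ ℕ) :
    ∃ r : ℝ, MvPolynomial.coeff c p = (r : ℂ) := by
  rw [← Complex.conj_eq_iff_real, ← MvPolynomial.coeff_map, hp]

/-- The pencil `z I + ∑ i, z_i A_i` of Hermitian matrices has determinant fixed by
coefficientwise conjugation. -/
theorem map_conj_det_hermitian_pencil {σ ι n : Type*} [Fintype ι] [Fintype n] [DecidableEq n]
    (s : σ) (t : ι → σ) (A : ι → Matrix n n ℂ) (hA : ∀ i, (A i).IsHermitian) :
    MvPolynomial.map (starRingEnd ℂ)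
        (Matrix.det ((X s : MvPolynomial σ ℂ) • (1 : Matrix n n (MvPolynomial σ ℂ)) +
          ∑ i, (X (t i) : MvPolynomial σ ℂ) • (A i).map C)) =
      Matrix.det ((X s : MvPolynomial σ ℂ) • (1 : Matrix n n (MvPolynomial σ ℂ)) +
        ∑ i, (X (t i) : MvPolynomial σ ℂ) • (A i).map C) := by
  rw [RingHom.map_det, ← Matrix.det_transpose]
  congr 1
  ext1 j k
  have hentry : ∀ i, (starRingEnd ℂ) (A i k j) = A i j k := fun i => (hA i).apply j k
  simp [Matrix.sum_apply, Matrix.one_apply, apply_ite, hentry, eq_comm]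

/-- The matrix `z I + ∑ i, z_i A_i` is nonsingular when the `A i` are positive semidefinite,
`z` lies in the open upper half-plane and the `z_i` lie in its closure. -/
theorem det_posSemidef_pencil_ne_zero {ι n : Type*} [Fintype ι] [Fintype n] [DecidableEq n]
    {z : ℂ} {w : ι → ℂ} (hz : 0 < z.im) (hw : ∀ i, 0 ≤ (w i).im) {A : ι → Matrix n n ℂ}
    (hA : ∀ i, (A i).PosSemidef) :
    Matrix.det (z • (1 : Matrix n n ℂ) + ∑ i, w i • A i) ≠ 0 := by
  intro hdet
  obtain ⟨v, hv, hker⟩ := Matrix.exists_mulVec_eq_zero_iff.mpr hdet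
  have hform : z * (star v ⬝ᵥ v) + ∑ i, w i * (star v ⬝ᵥ (A i).mulVec v) = 0 := by
    have h := congrArg (star v ⬝ᵥ ·) hker
    simpa [Matrix.add_mulVec, Matrix.sum_mulVec, Matrix.smul_mulVec, dotProduct_add,
      dotProduct_sum, dotProduct_smul] using h
  have hnorm := Complex.pos_iff.mp (Matrix.dotProduct_star_self_pos_iff.mpr hv)
  have hquad := fun i => Complex.nonneg_iff.mp ((hA i).dotProduct_mulVec_nonneg v)
  have him := congrArg Complex.im hform
  simp only [Complex.add_im, Complex.im_sum, Complex.mul_im, ← hnorm.2, ← (hquad _).2,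
    mul_zero, zero_add, Complex.zero_im] at him
  exact (add_pos_of_pos_of_nonneg (mul_pos hz hnorm.1)
    (Finset.sum_nonneg fun i _ => mul_nonneg (hw i) (hquad i).1)).ne' him

/-- If `A₁, …, A_m ∈ M_d(ℂ)` are positive semidefinite, then the polynomial
`q(z, z₁, …, z_m) = det (z I_d + ∑ i, z_i A_i)` in `m + 1` variables is real stable.
Here variable `0` plays the role of `z` and variable `i.succ` the role of `z_i`. -/
theorem det_poly_real_stable (d m : ℕ) (A : Fin m → Matrix (Fin d) (Fin d) ℂ)
    (hA : ∀ i, (A i).PosSemidef) :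
    RealStable
      (Matrix.det
        ((MvPolynomial.X (0 : Fin (m + 1)) : MvPolynomial (Fin (m + 1)) ℂ) •
            (1 : Matrix (Fin d) (Fin d) (MvPolynomial (Fin (m + 1)) ℂ)) +
          ∑ i : Fin m,
            (MvPolynomial.X i.succ : MvPolynomial (Fin (m + 1)) ℂ) •
              (A i).map MvPolynomial.C)) := by
  refine ⟨exists_real_coeff_of_map_conj_eq_self
    (map_conj_det_hermitian_pencil 0 Fin.succ A fun i => (hA i).isHermitian), fun w hw => ?_⟩
  rw [RingHom.map_det]
  convert det_posSemidef_pencil_ne_zero (hw 0) (fun i : Fin m => (hw i.succ).le) hA using 2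
  ext j k
  simp [Matrix.sum_apply, Matrix.one_apply, apply_ite]
end

section
/- Let p(z_1, ..., z_m) be a real stable polynomial and let t ∈ ℝ. Then the polynomial (1 + t·∂_m)p, where ∂_m denotes the partial derivative with respect to the variable z_m, is real stable. -/
open MvPolynomial

/-- A nonempty multiset of complex numbers in the open lower half-plane has its sum there. -/
theorem Complex.im_multiset_sum_neg {s : Multiset ℂ} (hs : s ≠ 0) (h : ∀ z ∈ s, z.im < 0) :
    s.sum.im < 0 := by
  induction s using Multiset.induction_on with
  | empty => exact absurd rfl hs
  | cons a s ih =>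
    rw [Multiset.sum_cons, Complex.add_im]
    have ha := h a (Multiset.mem_cons_self a s)
    rcases eq_or_ne s 0 with rfl | hs'
    · simpa using ha
    · exact add_neg ha (ih hs' fun z hz => h z (Multiset.mem_cons_of_mem hz))

/-- A univariate polynomial `q` without zeros in the open upper half-plane stays so after
replacing it by `q + t q'` for real `t`. -/
theorem Polynomial.eval_add_mul_eval_derivative_ne_zero {q : Polynomial ℂ}
    (hq : ∀ z : ℂ, 0 < z.im → q.eval z ≠ 0) (t : ℝ) {z : ℂ} (hz : 0 < z.im) :
    q.eval z + t * q.derivative.eval z ≠ 0 := by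
  have hqz := hq z hz
  rw [(IsAlgClosed.splits q).eval_derivative_eq_eval_mul_sum hqz, mul_left_comm,
    ← mul_one_add]
  refine mul_ne_zero hqz fun h0 => ?_
  rcases eq_or_ne q.roots 0 with hr | hr
  · simp [hr] at h0
  have hneg : ((q.roots.map fun r => 1 / (z - r)).sum).im < 0 := by
    refine Complex.im_multiset_sum_neg (by simpa using hr) fun y hy => ?_
    obtain ⟨r, hrm, rfl⟩ := Multiset.mem_map.1 hy
    have hrim : r.im ≤ 0 := not_lt.1 fun hpos => hq r hpos (Polynomial.isRoot_of_mem_roots hrm)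
    have him : 0 < (z - r).im := by rw [Complex.sub_im]; linarith
    have hne : z - r ≠ 0 := fun h => by simp [h] at him
    rw [one_div, Complex.inv_im]
    exact div_neg_of_neg_of_pos (neg_neg_of_pos him) (Complex.normSq_pos.2 hne)
  have him := congrArg Complex.im h0
  simp only [Complex.add_im, Complex.one_im, Complex.im_ofReal_mul, zero_add,
    Complex.zero_im] at him
  have ht : t = 0 := (mul_eq_zero.1 him).resolve_right hneg.ne
  simp [ht] at h0

/-- The restriction of a multivariate polynomial to the line through `w` in direction `i`. -/
noncomputable def MvPolynomial.restrictLine {R σ : Type*} [CommRing R] [DecidableEq σ]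
    (w : σ → R) (i : σ) : MvPolynomial σ R →ₐ[R] Polynomial R :=
  MvPolynomial.aeval (Function.update (fun j => Polynomial.C (w j)) i Polynomial.X)

theorem MvPolynomial.eval_restrictLine {R σ : Type*} [CommRing R] [DecidableEq σ]
    (w : σ → R) (i : σ) (p : MvPolynomial σ R) (x : R) :
    (restrictLine w i p).eval x = MvPolynomial.eval (Function.update w i x) p := by
  induction p using MvPolynomial.induction_on with
  | C a => simp [restrictLine]
  | add p q hp hq => simp [hp, hq]
  | mul_X p j hp =>
    rw [map_mul, Polynomial.eval_mul, hp, map_mul, MvPolynomial.eval_X]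
    rcases eq_or_ne j i with rfl | hj
    · simp [restrictLine]
    · simp [restrictLine, hj]

theorem MvPolynomial.derivative_restrictLine {R σ : Type*} [CommRing R] [DecidableEq σ]
    (w : σ → R) (i : σ) (p : MvPolynomial σ R) :
    (restrictLine w i p).derivative = restrictLine w i (MvPolynomial.pderiv i p) := by
  induction p using MvPolynomial.induction_on with
  | C a => simp [restrictLine]
  | add p q hp hq => simp [hp, hq]
  | mul_X p j hp =>
    rw [map_mul, Polynomial.derivative_mul, hp, MvPolynomial.pderiv_mul, map_add, map_mul, map_mul]
    rcases eq_or_ne j i with rfl | hj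
    · simp [restrictLine]
    · simp [restrictLine, hj, MvPolynomial.pderiv_X_of_ne hj]

/-- If `p(z₁, …, z_m)` is a real stable polynomial in `m = k + 1` variables and `t ∈ ℝ`,
then `(1 + t ∂_m) p` is real stable, where `∂_m` is the partial derivative with respect
to the last variable. -/
theorem realStable_one_add_smul_pderiv (k : ℕ) (p : MvPolynomial (Fin (k + 1)) ℂ)
    (hp : RealStable p) (t : ℝ) :
    RealStable (p + (MvPolynomial.C (t : ℂ)) * MvPolynomial.pderiv (Fin.last k) p) := by
  obtain ⟨hreal, hstable⟩ := hp
  refine ⟨fun c => ?_, fun w hw => ?_⟩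
  · obtain ⟨a, ha⟩ := hreal c
    obtain ⟨b, hb⟩ := hreal (c + Finsupp.single (Fin.last k) 1)
    refine ⟨a + t * (b * (c (Fin.last k) + 1)), ?_⟩
    rw [MvPolynomial.coeff_add, MvPolynomial.coeff_C_mul, MvPolynomial.coeff_pderiv, ha, hb]
    push_cast
    ring
  · have hq : ∀ z : ℂ, 0 < z.im → (restrictLine w (Fin.last k) p).eval z ≠ 0 := by
      intro z hz
      rw [MvPolynomial.eval_restrictLine]
      refine hstable _ fun i => ?_
      rcases eq_or_ne i (Fin.last k) with rfl | hi
      · simpa using hz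
      · simpa [hi] using hw i
    have key := Polynomial.eval_add_mul_eval_derivative_ne_zero hq t (hw (Fin.last k))
    rw [MvPolynomial.derivative_restrictLine, MvPolynomial.eval_restrictLine,
      MvPolynomial.eval_restrictLine, Function.update_eq_self] at key
    simpa using key
end

section
/- Let A_1, ..., A_m ∈ M_d(ℂ) be positive semidefinite Hermitian matrices. Then the mixed characteristic polynomial μ[A_1, ..., A_m](z) has only real roots. -/
open MvPolynomial
open scoped ComplexOrder

/-- The *mixed characteristic polynomial*
`μ[A₁,…,A_m](z) = ∏_{i=1}^m (1 - ∂_i) det (z I_d + ∑ i, z_i A_i) |_{z₁ = ⋯ = z_m = 0}`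
of the matrices `A₁, …, A_m ∈ M_d(ℂ)`, as a one-variable polynomial over `ℂ`.
We work in `m + 1` variables, variable `0` playing the role of `z` and variable
`i.succ` the role of `z_i`. -/
noncomputable def mixedCharPoly {d m : ℕ} (A : Fin m → Matrix (Fin d) (Fin d) ℂ) :
    Polynomial ℂ :=
  MvPolynomial.eval₂ Polynomial.C
    (Fin.cases Polynomial.X (fun _ : Fin m => 0))
    ((List.finRange m).foldr (fun i q => q - MvPolynomial.pderiv i.succ q)
      (Matrix.det
        ((MvPolynomial.X (0 : Fin (m + 1)) : MvPolynomial (Fin (m + 1)) ℂ) •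
            (1 : Matrix (Fin d) (Fin d) (MvPolynomial (Fin (m + 1)) ℂ)) +
          ∑ i : Fin m,
            (MvPolynomial.X i.succ : MvPolynomial (Fin (m + 1)) ℂ) •
              (A i).map MvPolynomial.C)))

/-- If all roots of `f` lie strictly below the real axis (above it, if `s < 0`), then `f - f'`
does not vanish on the opposite closed half plane. -/
theorem Polynomial.eval_sub_derivative_ne_zero_of_half_plane {s : ℝ} {f : Polynomial ℂ}
    (hf : ∀ w : ℂ, 0 ≤ s * w.im → f.eval w ≠ 0) {w : ℂ} (hw : 0 ≤ s * w.im) :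
    (f - Polynomial.derivative f).eval w ≠ 0 := by
  have hfw := hf w hw
  intro h
  rw [Polynomial.eval_sub, sub_eq_zero] at h
  have hsum := (IsAlgClosed.splits f).eval_derivative_div_eval_of_ne_zero hfw
  rw [← h, div_self hfw] at hsum
  have hneg : ∀ r ∈ f.roots, s * (1 / (w - r)).im < 0 := by
    intro r hr
    have hr' : s * r.im < 0 := by
      by_contra! hcon
      exact hf r hcon (Polynomial.isRoot_of_mem_roots hr)
    have hne : w - r ≠ 0 := by
      intro h0
      rw [sub_eq_zero.mp h0] at hw
      exact absurd hw hr'.not_ge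
    rw [one_div, Complex.inv_im, ← mul_div_assoc]
    refine div_neg_of_neg_of_pos ?_ (Complex.normSq_pos.mpr hne)
    rw [Complex.sub_im]
    linarith
  have him : s * ((f.roots.map fun r => 1 / (w - r)).sum).im = 0 := by
    rw [← hsum]; simp
  have hcoe : s * ((f.roots.map fun r => 1 / (w - r)).sum).im
      = (f.roots.map fun r => s * (1 / (w - r)).im).sum := by
    rw [← Complex.imLm_coe, map_multiset_sum, Multiset.map_map, ← Multiset.sum_map_mul_left]
    rfl
  rcases eq_or_ne f.roots 0 with h0 | h0
  · rw [h0] at hsum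
    simp at hsum
  · have hlt := Multiset.sum_lt_sum_of_nonempty h0 hneg
    rw [← hcoe, him] at hlt
    simp at hlt

/-- Specialising all variables but one turns `pderiv` into the derivative. -/
theorem MvPolynomial.derivative_eval₂_update {σ R : Type*} [DecidableEq σ] [CommRing R]
    (w : σ → R) (i : σ) (q : MvPolynomial σ R) :
    Polynomial.derivative
        (eval₂ Polynomial.C (Function.update (fun j => Polynomial.C (w j)) i Polynomial.X) q) =
      eval₂ Polynomial.C (Function.update (fun j => Polynomial.C (w j)) i Polynomial.X)
        (pderiv i q) := by
  induction q using MvPolynomial.induction_on with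
  | C a => simp
  | add p q hp hq => simp [hp, hq]
  | mul_X p j hp =>
    rcases eq_or_ne j i with rfl | hj
    · simp [Polynomial.derivative_mul, hp]
      ring
    · simp [Polynomial.derivative_mul, hp, hj, pderiv_X_of_ne hj, mul_comm]

/-- Evaluating after specialising all variables but one. -/
theorem MvPolynomial.eval_eval₂_update {σ R : Type*} [DecidableEq σ] [CommRing R]
    (w : σ → R) (i : σ) (x : R) (q : MvPolynomial σ R) :
    (eval₂ Polynomial.C (Function.update (fun j => Polynomial.C (w j)) i Polynomial.X) q).eval x =
      eval (Function.update w i x) q := by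
  induction q using MvPolynomial.induction_on with
  | C a => simp
  | add p q hp hq => simp [hp, hq]
  | mul_X p j hp =>
    rcases eq_or_ne j i with rfl | hj
    · simp [hp]
    · simp [hp, hj]

/-- `q` does not vanish where variable `0` lies in the open half plane `0 < s * im` and the other
variables lie in the closed half plane `0 ≤ s * im`. -/
def HalfPlaneStable {m : ℕ} (s : ℝ) (q : MvPolynomial (Fin (m + 1)) ℂ) : Prop :=
  ∀ w : Fin (m + 1) → ℂ, 0 < s * (w 0).im → (∀ i : Fin m, 0 ≤ s * (w i.succ).im) → eval w q ≠ 0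

theorem HalfPlaneStable.sub_pderiv {m : ℕ} {s : ℝ} {q : MvPolynomial (Fin (m + 1)) ℂ}
    (hq : HalfPlaneStable s q) (i : Fin m) : HalfPlaneStable s (q - pderiv i.succ q) := by
  intro w h0 hw
  have key := Polynomial.eval_sub_derivative_ne_zero_of_half_plane (s := s)
    (f := eval₂ Polynomial.C
      (Function.update (fun j => Polynomial.C (w j)) i.succ Polynomial.X) q) (w := w i.succ)
    (fun x hx => ?_) (hw i)
  · rwa [derivative_eval₂_update, Polynomial.eval_sub, eval_eval₂_update, eval_eval₂_update,
      Function.update_eq_self, ← map_sub] at key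
  · rw [eval_eval₂_update]
    refine hq _ ?_ fun j => ?_
    · rwa [Function.update_of_ne (Fin.succ_ne_zero i).symm]
    · rcases eq_or_ne j i with rfl | hj
      · simpa using hx
      · rw [Function.update_of_ne (by simpa using hj)]
        exact hw j

theorem Matrix.det_smul_one_add_sum_ne_zero {ι n : Type*} [Fintype ι] [Fintype n] [DecidableEq n]
    {A : ι → Matrix n n ℂ} (hA : ∀ i, (A i).PosSemidef) {s : ℝ} {z : ℂ} (hz : 0 < s * z.im)
    {w : ι → ℂ} (hw : ∀ i, 0 ≤ s * (w i).im) :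
    (z • (1 : Matrix n n ℂ) + ∑ i, w i • A i).det ≠ 0 := by
  intro hdet
  obtain ⟨v, hv, hv0⟩ := Matrix.exists_mulVec_eq_zero_iff.mpr hdet
  have hquad : z * (star v ⬝ᵥ v) + ∑ i, w i * (star v ⬝ᵥ (A i).mulVec v) = 0 := by
    have := congrArg (fun u => star v ⬝ᵥ u) hv0
    simpa [Matrix.add_mulVec, Matrix.sum_mulVec, Matrix.smul_mulVec, dotProduct_add,
      dotProduct_sum, dotProduct_smul] using this
  have him (c a : ℂ) (ha : 0 ≤ a) : (c * a).im = c.im * a.re := by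
    rw [Complex.mul_im, ← (Complex.nonneg_iff.mp ha).2]
    ring
  have hpos : 0 < star v ⬝ᵥ v := dotProduct_star_self_pos_iff.mpr hv
  have hsum := congrArg (fun c => s * c.im) hquad
  simp only [Complex.add_im, Complex.im_sum, him _ _ hpos.le,
    him _ _ ((hA _).dotProduct_mulVec_nonneg v), mul_add, Finset.mul_sum, ← mul_assoc,
    Complex.zero_im, mul_zero] at hsum
  have h₁ : 0 < s * z.im * (star v ⬝ᵥ v).re := mul_pos hz (Complex.pos_iff.mp hpos).1
  have h₂ : 0 ≤ ∑ i, s * (w i).im * (star v ⬝ᵥ (A i).mulVec v).re :=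
    Finset.sum_nonneg fun i _ => mul_nonneg (hw i)
      (Complex.nonneg_iff.mp ((hA i).dotProduct_mulVec_nonneg v)).1
  linarith

theorem halfPlaneStable_det {d m : ℕ} {A : Fin m → Matrix (Fin d) (Fin d) ℂ}
    (hA : ∀ i, (A i).PosSemidef) (s : ℝ) :
    HalfPlaneStable s (Matrix.det
        ((MvPolynomial.X (0 : Fin (m + 1)) : MvPolynomial (Fin (m + 1)) ℂ) •
            (1 : Matrix (Fin d) (Fin d) (MvPolynomial (Fin (m + 1)) ℂ)) +
          ∑ i : Fin m,
            (MvPolynomial.X i.succ : MvPolynomial (Fin (m + 1)) ℂ) •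
              (A i).map MvPolynomial.C)) := by
  intro w h0 hw
  rw [RingHom.map_det]
  convert Matrix.det_smul_one_add_sum_ne_zero hA h0 hw using 2
  ext j k
  simp [Matrix.sum_apply, Matrix.one_apply, apply_ite]

theorem HalfPlaneStable.foldr_sub_pderiv {m : ℕ} {s : ℝ} {q : MvPolynomial (Fin (m + 1)) ℂ}
    (hq : HalfPlaneStable s q) (l : List (Fin m)) :
    HalfPlaneStable s (l.foldr (fun i q => q - pderiv i.succ q) q) := by
  induction l with
  | nil => exact hq
  | cons i l ih => exact ih.sub_pderiv i

theorem HalfPlaneStable.eval_eval₂_ne_zero {m : ℕ} {s : ℝ} {q : MvPolynomial (Fin (m + 1)) ℂ}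
    (hq : HalfPlaneStable s q) {z : ℂ} (hz : 0 < s * z.im) :
    (eval₂ Polynomial.C (Fin.cases Polynomial.X (fun _ : Fin m => 0)) q).eval z ≠ 0 := by
  have h := hq (Fin.cases z fun _ => 0) (by simpa using hz) (by simp)
  convert h using 1
  rw [← Polynomial.coe_evalRingHom, MvPolynomial.hom_eval₂, MvPolynomial.eval, coe_eval₂Hom]
  congr 1
  · ext; simp
  · funext j
    cases j using Fin.cases <;> simp

/-- If `A₁, …, A_m ∈ M_d(ℂ)` are positive semidefinite, then the mixed characteristic
polynomial `μ[A₁, …, A_m]` has only real roots. -/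
theorem mixedCharPoly_roots_real (d m : ℕ) (A : Fin m → Matrix (Fin d) (Fin d) ℂ)
    (hA : ∀ i, (A i).PosSemidef) :
    ∀ z : ℂ, (mixedCharPoly A).eval z = 0 → z.im = 0 := by
  intro z hz
  by_contra him
  exact ((halfPlaneStable_det hA z.im).foldr_sub_pderiv _).eval_eval₂_ne_zero
    (mul_self_pos.mpr him) hz
end

section
/- Let ε > 0 and let A_1, ..., A_m ∈ M_d(ℂ) be positive semidefinite Hermitian matrices such that Σ_{i=1}^m A_i = I_d and Tr A_i ≤ ε for every i = 1, ..., m. Then every root of the mixed characteristic polynomial μ[A_1, ..., A_m] is strictly smaller than (1 + √ε)². -/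
open MvPolynomial
open scoped ComplexOrder

namespace Polynomial

open Filter Topology
open scoped ComplexConjugate

/-- If no root of `f` lies in the open upper half-plane, then `f' / f` maps the closed upper
half-plane to the closed lower one. -/
lemma im_logDeriv_nonpos {f : ℂ[X]} (hf : ∀ z : ℂ, 0 < z.im → f.eval z ≠ 0) {s : ℂ}
    (hs : 0 ≤ s.im) : (f.derivative.eval s * conj (f.eval s)).im ≤ 0 := by
  by_cases h0 : f.eval s = 0
  · simp [h0]
  have key := (IsAlgClosed.splits f).eval_derivative_div_eval_of_ne_zero h0
  have hsum : (f.derivative.eval s / f.eval s).im ≤ 0 := by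
    rw [key, ← Complex.coe_imAddGroupHom, map_multiset_sum, Multiset.map_map]
    refine (Multiset.sum_le_card_nsmul _ 0 fun x hx => ?_).trans (by simp)
    obtain ⟨r, hr, rfl⟩ := Multiset.mem_map.1 hx
    have hr' : r.im ≤ 0 := by
      by_contra! h
      exact hf r h (isRoot_of_mem_roots hr)
    simp only [Function.comp, Complex.coe_imAddGroupHom, one_div, Complex.inv_im, Complex.sub_im]
    exact div_nonpos_of_nonpos_of_nonneg (by linarith) (Complex.normSq_nonneg _)
  have e : f.derivative.eval s * conj (f.eval s)
      = (f.derivative.eval s / f.eval s) * ((Complex.normSq (f.eval s) : ℝ) : ℂ) := by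
    rw [← Complex.mul_conj]; field_simp
  rw [e, Complex.im_mul_ofReal]
  exact mul_nonpos_of_nonpos_of_nonneg hsum (Complex.normSq_nonneg _)

/-- If no root of `f` lies in the open upper half-plane, then neither does any of `f - f'`. -/
lemma eval_sub_derivative_ne_zero {f : ℂ[X]} (hf : ∀ z : ℂ, 0 < z.im → f.eval z ≠ 0) {s : ℂ}
    (hs : 0 < s.im) : f.eval s - f.derivative.eval s ≠ 0 := by
  intro h
  have h0 := hf s hs
  have key := (IsAlgClosed.splits f).eval_derivative_div_eval_of_ne_zero h0
  rw [← sub_eq_zero.1 h, div_self h0] at key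
  have hne : f.roots ≠ 0 := by
    intro h; simp [h] at key
  have hlt : ((f.roots.map fun z => 1 / (s - z)).sum).im < 0 := by
    rw [← Complex.coe_imAddGroupHom, map_multiset_sum, Multiset.map_map]
    have := Multiset.sum_lt_sum_of_nonempty (s := f.roots)
      (f := (⇑Complex.imAddGroupHom ∘ fun z => 1 / (s - z))) (g := fun _ => (0 : ℝ)) hne ?_
    · simpa using this
    intro r hr
    have hr' : r.im ≤ 0 := by
      by_contra! h
      exact hf r h (isRoot_of_mem_roots hr)
    have hsr : s - r ≠ 0 := by
      intro h
      have := congrArg Complex.im h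
      simp at this; linarith
    simp only [Function.comp, Complex.coe_imAddGroupHom, one_div, Complex.inv_im, Complex.sub_im]
    exact div_neg_of_neg_of_pos (by linarith) (Complex.normSq_pos.2 hsr)
  rw [← key] at hlt
  simp at hlt

/-- The derivative of the logarithmic derivative of a product of linear factors. -/
lemma logDeriv_deriv_multiset_prod (s : ℂ) (t : Multiset ℂ) (ht : ∀ r ∈ t, s - r ≠ 0) :
    let f : ℂ[X] := (t.map fun r => X - C r).prod
    f.eval s ≠ 0 ∧ (f.derivative.derivative.eval s * f.eval s - f.derivative.eval s ^ 2) /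
      f.eval s ^ 2 = -(t.map fun r => 1 / (s - r) ^ 2).sum := by
  induction t using Multiset.induction_on with
  | empty => simp
  | cons a t ih =>
    obtain ⟨h0, h1⟩ := ih fun r hr => ht r (Multiset.mem_cons_of_mem hr)
    have ha := ht a (Multiset.mem_cons_self a t)
    simp only [Multiset.map_cons, Multiset.prod_cons, Multiset.sum_cons, derivative_mul,
      derivative_sub, derivative_X, derivative_C, sub_zero, one_mul, eval_mul, eval_add, eval_sub,
      eval_X, eval_C, derivative_add]
    generalize hg : (t.map fun r => X - C r).prod = g at *
    refine ⟨mul_ne_zero ha h0, ?_⟩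
    rw [neg_add, ← h1]
    field_simp
    ring

/-- If every root `r` of `f` satisfies `r.im ≤ s.im` and `r.re ≤ s.re`, then the derivative of
`f' / f` has nonnegative imaginary part at `s`. -/
lemma im_deriv_logDeriv_nonneg {f : ℂ[X]} {s : ℂ} (h0 : f.eval s ≠ 0)
    (hf : ∀ r, f.eval r = 0 → r.im ≤ s.im ∧ r.re ≤ s.re) :
    0 ≤ ((f.derivative.derivative.eval s * f.eval s - f.derivative.eval s ^ 2) *
      conj (f.eval s) ^ 2).im := by
  obtain ⟨hg, key⟩ := logDeriv_deriv_multiset_prod s f.roots fun r hr h => h0 <| by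
    rw [sub_eq_zero.1 h]; exact isRoot_of_mem_roots hr
  have hfac := (IsAlgClosed.splits f).eq_prod_roots
  set g := (f.roots.map fun r => X - C r).prod
  have hc : f.leadingCoeff ≠ 0 := by
    intro h; rw [leadingCoeff_eq_zero] at h; simp [h] at h0
  have e1 : (f.derivative.derivative.eval s * f.eval s - f.derivative.eval s ^ 2) /
      f.eval s ^ 2 = -(f.roots.map fun r => 1 / (s - r) ^ 2).sum := by
    rw [← key]
    conv_lhs => rw [hfac]
    simp only [derivative_C_mul, eval_mul, eval_C]
    field_simp
  have hsum : 0 ≤ (-(f.roots.map fun r => 1 / (s - r) ^ 2).sum).im := by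
    rw [Complex.neg_im, neg_nonneg, ← Complex.coe_imAddGroupHom, map_multiset_sum,
      Multiset.map_map]
    refine (Multiset.sum_le_card_nsmul _ 0 fun x hx => ?_).trans (by simp)
    obtain ⟨r, hr, rfl⟩ := Multiset.mem_map.1 hx
    obtain ⟨h1, h2⟩ := hf r (isRoot_of_mem_roots hr)
    simp only [Function.comp, Complex.coe_imAddGroupHom, one_div, Complex.inv_im]
    refine div_nonpos_of_nonpos_of_nonneg ?_ (Complex.normSq_nonneg _)
    rw [neg_nonpos, sq, Complex.mul_im, Complex.sub_re, Complex.sub_im]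
    have := mul_nonneg (sub_nonneg.2 h1) (sub_nonneg.2 h2)
    linarith
  have e : (f.derivative.derivative.eval s * f.eval s - f.derivative.eval s ^ 2) *
      conj (f.eval s) ^ 2 = (f.derivative.derivative.eval s * f.eval s - f.derivative.eval s ^ 2) /
      f.eval s ^ 2 * ((Complex.normSq (f.eval s) ^ 2 : ℝ) : ℂ) := by
    push_cast
    rw [← Complex.mul_conj]; field_simp
  rw [e, Complex.im_mul_ofReal, e1]
  exact mul_nonneg hsum (by positivity)

/-- If no root of `f` lies in the open upper half-plane, then `|f|` increases along upward vertical
rays in the closed upper half-plane. -/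
lemma norm_eval_le_of_im_le {f : ℂ[X]} (hf : ∀ z : ℂ, 0 < z.im → f.eval z ≠ 0) {a b b' : ℝ}
    (hb : 0 ≤ b') (hbb : b' ≤ b) : ‖f.eval ⟨a, b'⟩‖ ≤ ‖f.eval ⟨a, b⟩‖ := by
  have h : ∀ t : Multiset ℂ, (∀ r ∈ t, r.im ≤ 0) →
      ‖((t.map fun r => X - C r).prod : ℂ[X]).eval (⟨a, b'⟩ : ℂ)‖ ≤
        ‖((t.map fun r => X - C r).prod : ℂ[X]).eval (⟨a, b⟩ : ℂ)‖ := by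
    intro t
    induction t using Multiset.induction_on with
    | empty => simp
    | cons r t ih =>
      intro ht
      have hr := ht r (Multiset.mem_cons_self r t)
      simp only [Multiset.map_cons, Multiset.prod_cons, eval_mul, norm_mul]
      gcongr
      · simp only [eval_sub, eval_X, eval_C]
        rw [Complex.norm_eq_sqrt_sq_add_sq, Complex.norm_eq_sqrt_sq_add_sq]
        apply Real.sqrt_le_sqrt
        simp only [Complex.sub_re, Complex.sub_im]
        nlinarith
      · exact ih fun r hr => ht r (Multiset.mem_cons_of_mem hr)
  rw [(IsAlgClosed.splits f).eq_prod_roots]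
  simp only [eval_mul, norm_mul, eval_C]
  gcongr
  refine h _ fun r hr => ?_
  by_contra! h
  exact hf r h (isRoot_of_mem_roots hr)

/-- A pair of real polynomials such that `D` has no root in the open upper half-plane and `N / D`
maps the open upper half-plane to the closed lower half-plane. -/
def IsPickPair (D N : ℝ[X]) : Prop :=
  ∀ z : ℂ, 0 < z.im → aeval z D ≠ 0 ∧ (aeval z N * conj (aeval z D)).im ≤ 0

/-- The complex polynomial `D + i y N`. -/
noncomputable def imPencil (D N : ℝ[X]) (y : ℝ) : ℂ[X] :=
  D.map (algebraMap ℝ ℂ) + C (Complex.I * y) * N.map (algebraMap ℝ ℂ)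

lemma eval_imPencil (D N : ℝ[X]) (y : ℝ) (z : ℂ) :
    (imPencil D N y).eval z = aeval z D + Complex.I * y * aeval z N := by
  simp [imPencil, eval_map_algebraMap]

lemma eval_imPencil_ofReal (D N : ℝ[X]) (y s : ℝ) :
    (imPencil D N y).eval (s : ℂ) = ⟨D.eval s, y * N.eval s⟩ := by
  have h : ∀ P : ℝ[X], aeval (s : ℂ) P = ((P.eval s : ℝ) : ℂ) := fun P => by
    simpa using aeval_algebraMap_apply_eq_algebraMap_eval (A := ℂ) s P
  rw [eval_imPencil, h, h]
  apply Complex.ext <;> simp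

lemma derivative_imPencil (D N : ℝ[X]) (y : ℝ) :
    (imPencil D N y).derivative = imPencil D.derivative N.derivative y := by
  simp [imPencil, derivative_map]

lemma aeval_conj_real (P : ℝ[X]) (z : ℂ) : aeval (conj z) P = conj (aeval z P) := by
  simpa using aeval_algHom_apply Complex.conjAe.toAlgHom z P

namespace IsPickPair

variable {D N : ℝ[X]}

lemma eval_imPencil_ne_zero (h : IsPickPair D N) {y : ℝ} (hy : 0 ≤ y) {z : ℂ} (hz : 0 < z.im) :
    (imPencil D N y).eval z ≠ 0 := by
  obtain ⟨h0, h1⟩ := h z hz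
  intro he
  rw [eval_imPencil] at he
  have h2 := congrArg (fun w => (w * conj (aeval z D)).re) he
  have e : (aeval z D + Complex.I * y * aeval z N) * conj (aeval z D)
      = ((Complex.normSq (aeval z D) : ℝ) : ℂ)
        + (y : ℂ) * (Complex.I * (aeval z N * conj (aeval z D))) := by
    rw [← Complex.mul_conj]; ring
  simp only [e, zero_mul, Complex.add_re, Complex.ofReal_re, Complex.re_ofReal_mul,
    Complex.I_mul_re, Complex.zero_re] at h2
  have := Complex.normSq_pos.2 h0
  nlinarith

lemma aeval_ne_zero (h : IsPickPair D N) (hD : ∀ s : ℝ, 0 ≤ s → D.eval s ≠ 0) {z : ℂ}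
    (hz : 0 ≤ z.re) : aeval z D ≠ 0 := by
  rcases lt_trichotomy z.im 0 with hi | hi | hi
  · have := (h (conj z) (by simpa using hi)).1
    rw [aeval_conj_real] at this
    simpa using this
  · have : z = ((z.re : ℝ) : ℂ) := by apply Complex.ext <;> simp [hi]
    rw [this]
    have h' := aeval_algebraMap_apply_eq_algebraMap_eval (A := ℂ) z.re D
    rw [Complex.coe_algebraMap] at h'
    rw [h']
    exact_mod_cast hD _ hz
  · exact (h z hi).1

/-- The numerator of `(N / D)'` is nonpositive on the real line. -/
lemma wronskian_nonpos (h : IsPickPair D N) (s : ℝ) :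
    N.derivative.eval s * D.eval s - N.eval s * D.derivative.eval s ≤ 0 := by
  have := im_logDeriv_nonpos (f := imPencil D N 1)
    (fun z hz => h.eval_imPencil_ne_zero zero_le_one hz) (s := (s : ℂ)) (by simp)
  rw [derivative_imPencil, eval_imPencil_ofReal, eval_imPencil_ofReal] at this
  simp at this
  linarith

lemma hasDerivAt_div {s : ℝ} (hs : D.eval s ≠ 0) :
    HasDerivAt (fun u => N.eval u / D.eval u)
      ((N.derivative.eval s * D.eval s - N.eval s * D.derivative.eval s) / D.eval s ^ 2) s :=
  (N.hasDerivAt s).fun_div (D.hasDerivAt s) hs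

lemma continuousOn_div (hD : ∀ s : ℝ, 0 ≤ s → D.eval s ≠ 0) :
    ContinuousOn (fun u => N.eval u / D.eval u) (Set.Ici 0) :=
  fun s hs => (hasDerivAt_div (hD s hs)).continuousAt.continuousWithinAt

lemma antitoneOn_div (h : IsPickPair D N) (hD : ∀ s : ℝ, 0 ≤ s → D.eval s ≠ 0) :
    AntitoneOn (fun u => N.eval u / D.eval u) (Set.Ici 0) := by
  refine antitoneOn_of_deriv_nonpos (convex_Ici 0) (continuousOn_div hD) ?_ ?_
  · intro s hs
    rw [interior_Ici] at hs
    exact (hasDerivAt_div (hD s hs.le)).differentiableAt.differentiableWithinAt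
  · intro s hs
    rw [interior_Ici] at hs
    rw [(hasDerivAt_div (hD s hs.le)).deriv]
    exact div_nonpos_of_nonpos_of_nonneg (h.wronskian_nonpos s) (sq_nonneg _)

lemma derivative_div_nonneg (h : IsPickPair D D.derivative)
    (hD : ∀ s : ℝ, 0 ≤ s → D.eval s ≠ 0) : 0 ≤ D.derivative.eval 0 / D.eval 0 := by
  have hD0 : D ≠ 0 := fun h => by simpa [h] using hD 0 le_rfl
  refine le_of_tendsto (div_tendsto_atTop_zero_of_degree_lt _ _ (degree_derivative_lt hD0)) ?_
  filter_upwards [eventually_ge_atTop 0] with s hs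
  exact h.antitoneOn_div hD Set.self_mem_Ici hs hs

lemma degree_le (h : IsPickPair D N) (hD : ∀ s : ℝ, 0 ≤ s → D.eval s ≠ 0)
    (hN : ∀ s : ℝ, 0 ≤ s → 0 ≤ N.eval s / D.eval s) : N.degree ≤ D.degree := by
  have hD0 : D ≠ 0 := fun h => by simpa [h] using hD 0 le_rfl
  by_contra! hlt
  have ht := abs_div_tendsto_atTop_atTop_of_degree_gt _ _ hlt hD0
  obtain ⟨s, hs, hs0⟩ :=
    ((ht.eventually_gt_atTop (N.eval 0 / D.eval 0)).and (eventually_ge_atTop 0)).exists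
  rw [abs_of_nonneg (hN s hs0)] at hs
  exact absurd (h.antitoneOn_div hD Set.self_mem_Ici hs0 hs0) (not_le.2 hs)

/-- `N / D` is bounded on the closed right half-plane. -/
lemma exists_norm_le (h : IsPickPair D N) (hD : ∀ s : ℝ, 0 ≤ s → D.eval s ≠ 0)
    (hN : ∀ s : ℝ, 0 ≤ s → 0 ≤ N.eval s / D.eval s) :
    ∃ K : ℝ, 0 < K ∧ ∀ z : ℂ, 0 ≤ z.re → ‖aeval z N‖ ≤ K * ‖aeval z D‖ := by
  have hdeg : (N.map (algebraMap ℝ ℂ)).degree ≤ (D.map (algebraMap ℝ ℂ)).degree := by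
    simpa using h.degree_le hD hN
  obtain ⟨K₁, hK₁⟩ := (isBigO_cobounded_of_degree_le hdeg).bound
  simp only [eval_map_algebraMap] at hK₁
  obtain ⟨R, hR⟩ := (Metric.hasBasis_cobounded_compl_closedBall (0 : ℂ)).eventually_iff.1 hK₁
  have hcomp : IsCompact (Metric.closedBall (0 : ℂ) R ∩ {z : ℂ | 0 ≤ z.re}) :=
    (isCompact_closedBall 0 R).inter_right (isClosed_le continuous_const Complex.continuous_re)
  obtain ⟨K₂, hK₂⟩ := hcomp.exists_bound_of_continuousOn (f := fun z => aeval z N / aeval z D)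
    (N.continuous_aeval.continuousOn.div D.continuous_aeval.continuousOn
      fun z hz => h.aeval_ne_zero hD hz.2)
  refine ⟨max 1 (max K₁ K₂), by positivity, fun z hz => ?_⟩
  by_cases hzR : z ∈ Metric.closedBall (0 : ℂ) R
  · have := hK₂ z ⟨hzR, hz⟩
    rw [norm_div, div_le_iff₀ (norm_pos_iff.2 (h.aeval_ne_zero hD hz))] at this
    exact this.trans (by gcongr; exact (le_max_right _ _).trans (le_max_right _ _))
  · exact (hR.2 hzR).trans (by gcongr; exact (le_max_left _ _).trans (le_max_right _ _))

/-- The product of the fourth power of `D` and `(N / D)''` is nonnegative on `[0, ∞)`. -/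
lemma second_deriv_nonneg (h : IsPickPair D N) (hD : ∀ s : ℝ, 0 ≤ s → D.eval s ≠ 0)
    (hN : ∀ s : ℝ, 0 ≤ s → 0 ≤ N.eval s / D.eval s) {s : ℝ} (hs : 0 ≤ s) :
    0 ≤ D.eval s ^ 2 * (N.derivative.derivative.eval s * D.eval s
        + D.derivative.derivative.eval s * N.eval s
        - 2 * D.derivative.eval s * N.derivative.eval s)
      - 2 * D.eval s * N.eval s *
        (D.derivative.derivative.eval s * D.eval s - D.derivative.eval s ^ 2) := by
  obtain ⟨K, hK, hKb⟩ := h.exists_norm_le hD hN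
  have hne : ∀ y : ℝ, 0 < y → y < K⁻¹ → ∀ z : ℂ, 0 ≤ z.re → (imPencil D N y).eval z ≠ 0 := by
    intro y hy hyK z hz he
    rw [eval_imPencil] at he
    have h1 : ‖aeval z D‖ = y * ‖aeval z N‖ := by
      rw [eq_neg_of_add_eq_zero_left he]
      simp [abs_of_pos hy]
    have h2 := hKb z hz
    have h3 := norm_pos_iff.2 (h.aeval_ne_zero hD hz)
    have h4 : y * K < 1 := by
      rwa [lt_inv_comm₀ hy hK, ← one_div, lt_div_iff₀ hy, mul_comm] at hyK
    nlinarith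
  set d₀ := D.eval s
  set d₁ := D.derivative.eval s
  set d₂ := D.derivative.derivative.eval s
  set n₀ := N.eval s
  set n₁ := N.derivative.eval s
  set n₂ := N.derivative.derivative.eval s
  have hpos : ∀ y : ℝ, 0 < y → y < K⁻¹ →
      0 ≤ (d₂ * n₀ + n₂ * d₀ - 2 * d₁ * n₁) * (d₀ ^ 2 - y ^ 2 * n₀ ^ 2)
        - 2 * d₀ * n₀ * (d₂ * d₀ - d₁ ^ 2 - y ^ 2 * (n₂ * n₀ - n₁ ^ 2)) := by
    intro y hy hyK
    have := im_deriv_logDeriv_nonneg (f := imPencil D N y) (s := (s : ℂ))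
      (hne y hy hyK _ (by simpa using hs)) fun r hr => ⟨?_, ?_⟩
    · simp only [derivative_imPencil, eval_imPencil_ofReal] at this
      simp [sq] at this
      refine le_of_mul_le_mul_left (a := y) ?_ hy
      linarith
    · by_contra! hc
      exact h.eval_imPencil_ne_zero hy.le (by simpa using hc) hr
    · by_contra! hc
      exact hne y hy hyK r (hs.trans (by simpa using hc.le)) hr
  have hlim : Tendsto (fun y : ℝ => (d₂ * n₀ + n₂ * d₀ - 2 * d₁ * n₁) * (d₀ ^ 2 - y ^ 2 * n₀ ^ 2)
        - 2 * d₀ * n₀ * (d₂ * d₀ - d₁ ^ 2 - y ^ 2 * (n₂ * n₀ - n₁ ^ 2))) (𝓝[>] 0)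
      (𝓝 ((d₂ * n₀ + n₂ * d₀ - 2 * d₁ * n₁) * (d₀ ^ 2 - 0 ^ 2 * n₀ ^ 2)
        - 2 * d₀ * n₀ * (d₂ * d₀ - d₁ ^ 2 - 0 ^ 2 * (n₂ * n₀ - n₁ ^ 2)))) :=
    (Continuous.tendsto (by fun_prop) 0).mono_left nhdsWithin_le_nhds
  have := ge_of_tendsto hlim (by
    filter_upwards [Ioo_mem_nhdsGT (inv_pos.2 hK)] with y hy
    exact hpos y hy.1 hy.2)
  linarith

/-- `N / D` lies above its tangents on `[0, ∞)`. -/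
lemma tangent_le (h : IsPickPair D N) (hD : ∀ s : ℝ, 0 ≤ s → D.eval s ≠ 0)
    (hN : ∀ s : ℝ, 0 ≤ s → 0 ≤ N.eval s / D.eval s) {δ : ℝ} (hδ : 0 < δ) :
    N.eval δ / D.eval δ - δ * ((N.derivative.eval δ * D.eval δ - N.eval δ * D.derivative.eval δ) /
      D.eval δ ^ 2) ≤ N.eval 0 / D.eval 0 := by
  set G : ℝ → ℝ := fun s =>
    (N.derivative.eval s * D.eval s - N.eval s * D.derivative.eval s) / D.eval s ^ 2
  have hG : ∀ s, 0 ≤ s → HasDerivAt G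
      ((((N.derivative.derivative.eval s * D.eval s + N.derivative.eval s * D.derivative.eval s)
        - (N.derivative.eval s * D.derivative.eval s + N.eval s * D.derivative.derivative.eval s))
        * D.eval s ^ 2 - (N.derivative.eval s * D.eval s - N.eval s * D.derivative.eval s) *
          (((2 : ℕ) : ℝ) * D.eval s ^ (2 - 1) * D.derivative.eval s)) / (D.eval s ^ 2) ^ 2) s :=
    fun s hs => (((N.derivative.hasDerivAt s).mul (D.hasDerivAt s)).sub
      ((N.hasDerivAt s).mul (D.derivative.hasDerivAt s))).fun_div ((D.hasDerivAt s).fun_pow 2)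
      (pow_ne_zero 2 (hD s hs))
  have hmono : MonotoneOn G (Set.Ici 0) := by
    refine monotoneOn_of_deriv_nonneg (convex_Ici 0)
      (fun s hs => (hG s hs).continuousAt.continuousWithinAt) ?_ ?_
    · intro s hs
      rw [interior_Ici] at hs
      exact (hG s hs.le).differentiableAt.differentiableWithinAt
    · intro s hs
      rw [interior_Ici] at hs
      rw [(hG s hs.le).deriv]
      refine div_nonneg ?_ (by positivity)
      have := h.second_deriv_nonneg hD hN hs.le
      norm_num
      linarith
  obtain ⟨c, hc, hc'⟩ := exists_hasDerivAt_eq_slope (fun u => N.eval u / D.eval u) G hδ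
    ((continuousOn_div hD).mono Set.Icc_subset_Ici_self)
    fun s hs => hasDerivAt_div (hD s hs.1.le)
  have hle : G c ≤ G δ := hmono hc.1.le hδ.le hc.2.le
  rw [hc', sub_zero, div_le_iff₀ hδ] at hle
  change N.eval δ / D.eval δ - δ * G δ ≤ _
  linarith

/-- The one-variable form of the barrier update: passing from `(D, N)` to `(D - D', N - N')` and
moving by `δ` does not increase the ratio, provided `D' / D ≤ 1 - 1 / δ` at the start. -/
lemma sub_derivative_div_le (h : IsPickPair D N) (h' : IsPickPair D D.derivative)
    (hD : ∀ s : ℝ, 0 ≤ s → D.eval s ≠ 0) (hN : ∀ s : ℝ, 0 ≤ s → 0 ≤ N.eval s / D.eval s)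
    {δ : ℝ} (hδ : 0 < δ) (hb : D.derivative.eval 0 / D.eval 0 ≤ 1 - δ⁻¹) :
    (N.eval δ - N.derivative.eval δ) / (D.eval δ - D.derivative.eval δ) ≤ N.eval 0 / D.eval 0 := by
  have hDδ := hD δ hδ.le
  have hG : D.derivative.eval δ / D.eval δ ≤ 1 - δ⁻¹ :=
    (h'.antitoneOn_div hD Set.self_mem_Ici hδ.le hδ.le).trans hb
  set G := D.derivative.eval δ / D.eval δ with hGdef
  set F' := (N.derivative.eval δ * D.eval δ - N.eval δ * D.derivative.eval δ) / D.eval δ ^ 2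
    with hF'
  have hF0 : F' ≤ 0 := div_nonpos_of_nonpos_of_nonneg (h.wronskian_nonpos δ) (sq_nonneg _)
  have hG1 : δ⁻¹ ≤ 1 - G := by linarith
  have hGpos : 0 < 1 - G := lt_of_lt_of_le (inv_pos.2 hδ) hG1
  have hGδ : (1 - G)⁻¹ ≤ δ := inv_le_of_inv_le₀ hδ hG1
  have e : (N.eval δ - N.derivative.eval δ) / (D.eval δ - D.derivative.eval δ)
      = N.eval δ / D.eval δ - F' * (1 - G)⁻¹ := by
    have h1 : D.eval δ - D.derivative.eval δ = D.eval δ * (1 - G) := by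
      rw [hGdef]; field_simp
    have h2 : N.eval δ - N.derivative.eval δ
        = D.eval δ * ((1 - G) * (N.eval δ / D.eval δ) - F') := by
      rw [hGdef, hF']; field_simp; ring
    rw [h1, h2]
    field_simp
  rw [e]
  refine le_trans ?_ (h.tangent_le hD hN hδ)
  nlinarith

end IsPickPair

end Polynomial

namespace MvPolynomial

open Filter Topology
open scoped ComplexConjugate

variable {σ : Type*}

/-- The restriction `u ↦ p (z + u v)` of a real polynomial to a line. -/
noncomputable def linePoly {K : Type*} [CommRing K] [Algebra ℝ K] (p : MvPolynomial σ ℝ)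
    (z v : σ → K) : Polynomial K :=
  aeval (fun k => Polynomial.C (z k) + Polynomial.C (v k) * Polynomial.X) p

lemma eval_linePoly {K : Type*} [CommRing K] [Algebra ℝ K] (p : MvPolynomial σ ℝ) (z v : σ → K)
    (u : K) : (linePoly p z v).eval u = aeval (fun k => z k + v k * u) p := by
  have := comp_aeval_apply (fun k => Polynomial.C (z k) + Polynomial.C (v k) * Polynomial.X)
    ((Polynomial.aeval u).restrictScalars ℝ) p
  simpa [linePoly, Polynomial.coe_aeval_eq_eval] using this

lemma aeval_linePoly (p : MvPolynomial σ ℝ) (x v : σ → ℝ) (u : ℂ) :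
    Polynomial.aeval u (linePoly p x v) = aeval (fun k => (x k : ℂ) + v k * u) p := by
  have := comp_aeval_apply (fun k => Polynomial.C (x k) + Polynomial.C (v k) * Polynomial.X)
    (Polynomial.aeval u : Polynomial ℝ →ₐ[ℝ] ℂ) p
  simpa [linePoly] using this

lemma derivative_linePoly [DecidableEq σ] {K : Type*} [CommRing K] [Algebra ℝ K]
    (p : MvPolynomial σ ℝ) (z : σ → K) (j : σ) :
    (linePoly p z (Pi.single j 1)).derivative = linePoly (pderiv j p) z (Pi.single j 1) := by
  induction p using MvPolynomial.induction_on with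
  | C a =>
    simp only [linePoly, algHom_C, pderiv_C, map_zero]
    rw [IsScalarTower.algebraMap_apply ℝ K (Polynomial K), Polynomial.algebraMap_eq,
      Polynomial.derivative_C]
  | add p q hp hq => simp_all [linePoly]
  | mul_X p k hp =>
    simp only [linePoly, map_mul, aeval_X, pderiv_mul, map_add, Polynomial.derivative_mul] at hp ⊢
    rw [hp, pderiv_X]
    by_cases hk : k = j
    · subst hk; simp
    · simp [hk]

lemma pderiv_pderiv_comm {R : Type*} [CommRing R] (i j : σ) (p : MvPolynomial σ R) :
    pderiv i (pderiv j p) = pderiv j (pderiv i p) := by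
  classical
  have h : ⁅(pderiv i : Derivation R (MvPolynomial σ R) (MvPolynomial σ R)),
      (pderiv j : Derivation R (MvPolynomial σ R) (MvPolynomial σ R))⁆ = 0 := by
    refine derivation_ext fun k => ?_
    simp only [Derivation.commutator_apply, pderiv_X, Pi.single_apply, Derivation.zero_apply]
    split_ifs <;> simp
  have := DFunLike.congr_fun h p
  rwa [Derivation.commutator_apply, Derivation.zero_apply, sub_eq_zero] at this

/-- A real polynomial is stable if it has no zero with all coordinates in the open upper
half-plane. -/
def IsStable (p : MvPolynomial σ ℝ) : Prop :=
  ∀ z : σ → ℂ, (∀ k, 0 < (z k).im) → aeval z p ≠ 0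

/-- All points above `x` (in the coordinatewise order) are non-zeros of `p`. -/
def IsAboveRoots (p : MvPolynomial σ ℝ) (x : σ → ℝ) : Prop :=
  ∀ y, x ≤ y → eval y p ≠ 0

/-- The barrier function `∂ⱼ p / p`. -/
noncomputable def barrier (p : MvPolynomial σ ℝ) (j : σ) (x : σ → ℝ) : ℝ :=
  eval x (pderiv j p) / eval x p

lemma eval_linePoly_update [DecidableEq σ] (p : MvPolynomial σ ℝ) (z : σ → ℂ) (j : σ) (u : ℂ) :
    (linePoly p (Function.update z j 0) (Pi.single j 1)).eval u
      = aeval (Function.update z j u) p := by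
  rw [eval_linePoly]
  congr 2
  ext k
  by_cases hk : k = j
  · subst hk; simp
  · simp [hk]

lemma IsStable.eval_linePoly_update_ne_zero [DecidableEq σ] {p : MvPolynomial σ ℝ}
    (hp : IsStable p) {z : σ → ℂ} (hz : ∀ k, 0 < (z k).im) (j : σ) (u : ℂ) (hu : 0 < u.im) :
    (linePoly p (Function.update z j 0) (Pi.single j 1)).eval u ≠ 0 := by
  rw [eval_linePoly_update]
  refine hp _ fun k => ?_
  by_cases hk : k = j
  · subst hk; simpa using hu
  · simpa [hk] using hz k

lemma IsStable.im_pderiv_nonpos {p : MvPolynomial σ ℝ} (hp : IsStable p) {z : σ → ℂ}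
    (hz : ∀ k, 0 < (z k).im) (j : σ) : (aeval z (pderiv j p) * conj (aeval z p)).im ≤ 0 := by
  classical
  have := Polynomial.im_logDeriv_nonpos (hp.eval_linePoly_update_ne_zero hz j) (hz j).le
  simpa only [derivative_linePoly, eval_linePoly_update, Function.update_eq_self] using this

lemma IsStable.sub_pderiv {p : MvPolynomial σ ℝ} (hp : IsStable p) (j : σ) :
    IsStable (p - pderiv j p) := by
  classical
  intro z hz
  have := Polynomial.eval_sub_derivative_ne_zero (hp.eval_linePoly_update_ne_zero hz j) (hz j)
  simpa only [derivative_linePoly, eval_linePoly_update, Function.update_eq_self, map_sub] using this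

lemma continuous_aeval_complex (p : MvPolynomial σ ℝ) :
    Continuous fun z : σ → ℂ => aeval z p := by
  simp_rw [aeval_def, ← eval_map]
  exact (MvPolynomial.continuous_eval _)

/-- Restricting a stable polynomial and its `j`-th partial derivative to a line with nonnegative
direction gives a Pick pair. -/
lemma IsStable.isPickPair {p : MvPolynomial σ ℝ} (hp : IsStable p) {x v : σ → ℝ} (hv : 0 ≤ v)
    (hx : eval x p ≠ 0) (j : σ) :
    Polynomial.IsPickPair (linePoly p x v) (linePoly (pderiv j p) x v) := by
  have htend : ∀ (q : MvPolynomial σ ℝ) (u : ℂ), Tendsto (fun y : ℝ =>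
      aeval (fun k => ((x k : ℂ) + y * Complex.I) + v k * u) q) (𝓝[>] 0)
      (𝓝 (Polynomial.aeval u (linePoly q x v))) := by
    intro q u
    rw [aeval_linePoly]
    have hc : Continuous fun y : ℝ => aeval (fun k => ((x k : ℂ) + y * Complex.I) + v k * u) q :=
      (continuous_aeval_complex q).comp (by fun_prop)
    have := hc.tendsto 0
    simp only [Complex.ofReal_zero, zero_mul, add_zero] at this
    exact this.mono_left nhdsWithin_le_nhds
  have him : ∀ (y : ℝ) (u : ℂ), 0 < y → 0 ≤ u.im →
      ∀ k, 0 < (((x k : ℂ) + y * Complex.I) + v k * u).im := by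
    intro y u hy hu k
    have := mul_nonneg (hv k) hu
    simp at this ⊢
    linarith
  intro u hu
  refine ⟨fun h0 => ?_, ?_⟩
  · have hmono : ∀ b : ℝ, 0 ≤ b → b ≤ u.im →
        ‖Polynomial.aeval (⟨u.re, b⟩ : ℂ) (linePoly p x v)‖
          ≤ ‖Polynomial.aeval (⟨u.re, u.im⟩ : ℂ) (linePoly p x v)‖ := by
      intro b hb hbu
      refine le_of_tendsto_of_tendsto (htend p _).norm (htend p _).norm ?_
      filter_upwards [self_mem_nhdsWithin] with y hy
      simp only [← eval_linePoly p (fun k => (x k : ℂ) + y * Complex.I) (fun k => (v k : ℂ))]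
      refine Polynomial.norm_eval_le_of_im_le (fun z hz => ?_) hb hbu
      rw [eval_linePoly]
      exact hp _ (him y z hy hz.le)
    have hzero : (linePoly p x v).map (algebraMap ℝ ℂ) = 0 := by
      refine Polynomial.eq_zero_of_infinite_isRoot _ ?_
      refine ((Set.Icc_infinite hu).image (f := fun b : ℝ => (⟨u.re, b⟩ : ℂ)) ?_).mono ?_
      · intro b _ b' _ h
        exact congrArg Complex.im h
      · rintro _ ⟨b, hb, rfl⟩
        have := hmono b hb.1 hb.2
        rw [Complex.eta, h0, norm_zero, norm_le_zero_iff] at this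
        simpa [Polynomial.IsRoot, Polynomial.eval_map_algebraMap] using this
    rw [Polynomial.map_eq_zero] at hzero
    refine hx ?_
    have := eval_linePoly p x v 0
    rw [hzero] at this
    simpa [aeval_eq_eval] using this.symm
  · refine le_of_tendsto (Complex.continuous_im.continuousAt.tendsto.comp
      ((htend (pderiv j p) u).mul
        ((Complex.continuous_conj.tendsto _).comp (htend p u)))) ?_
    filter_upwards [self_mem_nhdsWithin] with y hy
    exact hp.im_pderiv_nonpos (him y u hy hu.le) j

lemma aeval_ofReal (p : MvPolynomial σ ℝ) (x : σ → ℝ) :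
    aeval (fun k => (x k : ℂ)) p = ((eval x p : ℝ) : ℂ) := by
  simpa [Function.comp_def] using aeval_algebraMap_apply (B := ℂ) x p

lemma eval_linePoly_real (p : MvPolynomial σ ℝ) (x v : σ → ℝ) (u : ℝ) :
    (linePoly p x v).eval u = eval (fun k => x k + v k * u) p := by
  rw [eval_linePoly, aeval_eq_eval]

lemma IsAboveRoots.eval_linePoly_ne_zero {p : MvPolynomial σ ℝ} {x : σ → ℝ}
    (h : IsAboveRoots p x) {v : σ → ℝ} (hv : 0 ≤ v) (s : ℝ) (hs : 0 ≤ s) :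
    (linePoly p x v).eval s ≠ 0 := by
  rw [eval_linePoly_real]
  exact h _ fun k => le_add_of_nonneg_right (mul_nonneg (hv k) hs)

lemma IsAboveRoots.mono {p : MvPolynomial σ ℝ} {x y : σ → ℝ} (h : IsAboveRoots p x)
    (hxy : x ≤ y) : IsAboveRoots p y := fun z hz => h z (hxy.trans hz)

lemma IsStable.barrier_nonneg {p : MvPolynomial σ ℝ} (hp : IsStable p) {x : σ → ℝ}
    (hx : IsAboveRoots p x) (j : σ) : 0 ≤ barrier p j x := by
  classical
  have hv : (0 : σ → ℝ) ≤ Pi.single j 1 := Pi.single_nonneg.2 zero_le_one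
  have hpp := hp.isPickPair hv (hx x le_rfl) j
  rw [← derivative_linePoly] at hpp
  have := hpp.derivative_div_nonneg (hx.eval_linePoly_ne_zero hv)
  simpa [derivative_linePoly, eval_linePoly_real, barrier] using this

lemma IsStable.barrier_antitone {p : MvPolynomial σ ℝ} (hp : IsStable p) {x y : σ → ℝ}
    (hx : IsAboveRoots p x) (hxy : x ≤ y) (j : σ) : barrier p j y ≤ barrier p j x := by
  have hv : 0 ≤ y - x := sub_nonneg.2 hxy
  have := (hp.isPickPair hv (hx x le_rfl) j).antitoneOn_div (hx.eval_linePoly_ne_zero hv)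
    Set.self_mem_Ici (Set.mem_Ici.2 zero_le_one) zero_le_one
  simpa [eval_linePoly_real, barrier] using this

/-- The barrier update for the operator `1 - ∂ᵢ`: if the `i`-th barrier is at most `1 - 1 / δ`,
then moving by `δ` in direction `i` stays above the roots of `p - ∂ᵢ p`. -/
lemma IsStable.isAboveRoots_sub_pderiv [DecidableEq σ] {p : MvPolynomial σ ℝ} (hp : IsStable p)
    {x : σ → ℝ} (hx : IsAboveRoots p x) {i : σ} {δ : ℝ} (hδ : 0 < δ)
    (hb : barrier p i x ≤ 1 - δ⁻¹) : IsAboveRoots (p - pderiv i p) (x + Pi.single i δ) := by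
  intro y hy h0
  have hxy : x ≤ y := (le_add_of_nonneg_right (Pi.single_nonneg.2 hδ.le)).trans hy
  have h1 := (hp.barrier_antitone hx hxy i).trans hb
  rw [map_sub, sub_eq_zero] at h0
  rw [barrier, ← h0, div_self (hx y hxy)] at h1
  have := inv_pos.2 hδ
  linarith

/-- The barriers do not increase in the update for the operator `1 - ∂ᵢ`. -/
lemma IsStable.barrier_sub_pderiv_le [DecidableEq σ] {p : MvPolynomial σ ℝ} (hp : IsStable p)
    {x : σ → ℝ} (hx : IsAboveRoots p x) {i : σ} {δ : ℝ} (hδ : 0 < δ)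
    (hb : barrier p i x ≤ 1 - δ⁻¹) (j : σ) :
    barrier (p - pderiv i p) j (x + Pi.single i δ) ≤ barrier p j x := by
  have hv : (0 : σ → ℝ) ≤ Pi.single i 1 := Pi.single_nonneg.2 zero_le_one
  have hi := hp.isPickPair hv (hx x le_rfl) i
  have hj := hp.isPickPair hv (hx x le_rfl) j
  rw [← derivative_linePoly] at hi
  have hx0 : (fun k => x k + (Pi.single i 1 : σ → ℝ) k * 0) = x := by simp
  have hxδ : (fun k => x k + (Pi.single i 1 : σ → ℝ) k * δ) = x + Pi.single i δ := by
    ext k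
    by_cases hk : k = i
    · subst hk; simp
    · simp [hk]
  have := hj.sub_derivative_div_le hi (hx.eval_linePoly_ne_zero hv) (fun s hs => ?_) hδ ?_
  · simpa only [derivative_linePoly, eval_linePoly_real, hx0, hxδ, barrier, map_sub,
      pderiv_pderiv_comm i j] using this
  · rw [eval_linePoly_real, eval_linePoly_real]
    exact hp.barrier_nonneg
      (hx.mono fun k => le_add_of_nonneg_right (mul_nonneg (hv k) hs)) j
  · simpa only [derivative_linePoly, eval_linePoly_real, hx0, barrier] using hb

/-- The polynomial `∏_{i ∈ l} (1 - ∂ᵢ) p`. -/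
noncomputable def applyOneSubPderiv {R : Type*} [CommRing R] (l : List σ) (p : MvPolynomial σ R) :
    MvPolynomial σ R :=
  l.foldr (fun i q => q - pderiv i q) p

/-- Iterating the barrier update over a list of distinct variables. -/
lemma IsStable.isAboveRoots_applyOneSubPderiv [DecidableEq σ] {p : MvPolynomial σ ℝ} (hp : IsStable p)
    {x : σ → ℝ} (hx : IsAboveRoots p x) {δ : ℝ} (hδ : 0 < δ)
    (hb : ∀ j, barrier p j x ≤ 1 - δ⁻¹) (l : List σ) (hl : l.Nodup) :
    IsStable (applyOneSubPderiv l p) ∧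
      IsAboveRoots (applyOneSubPderiv l p) (x + fun k => if k ∈ l then δ else 0) ∧
      ∀ j, barrier (applyOneSubPderiv l p) j (x + fun k => if k ∈ l then δ else 0)
        ≤ 1 - δ⁻¹ := by
  induction l with
  | nil =>
    have h0 : (x + fun _ => (0 : ℝ)) = x := by ext; simp
    simpa [applyOneSubPderiv, h0] using ⟨hp, hx, hb⟩
  | cons i l ih =>
    obtain ⟨hi, hl⟩ := List.nodup_cons.1 hl
    obtain ⟨h1, h2, h3⟩ := ih hl
    have e : (x + fun k => if k ∈ i :: l then δ else 0)
        = (x + fun k => if k ∈ l then δ else 0) + Pi.single i δ := by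
      ext k
      by_cases hk : k = i
      · subst hk; simp [hi]
      · simp [hk]
    rw [e]
    exact ⟨h1.sub_pderiv i, h1.isAboveRoots_sub_pderiv h2 hδ (h3 i),
      fun j => (h1.barrier_sub_pderiv_le h2 hδ (h3 i) j).trans (h3 j)⟩

end MvPolynomial

section Determinant

variable {σ n : Type*} [Fintype σ] [Fintype n] [DecidableEq n]

/-- The determinantal polynomial `det (∑ i, z_i A_i)`. -/
noncomputable def detPoly (A : σ → Matrix n n ℂ) : MvPolynomial σ ℂ :=
  Matrix.det (∑ i, (X i : MvPolynomial σ ℂ) • (A i).map C)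

lemma map_detPoly {R : Type*} [CommRing R] (A : σ → Matrix n n ℂ) (f : MvPolynomial σ ℂ →+* R) :
    f (detPoly A) = Matrix.det (∑ i, f (X i) • (A i).map (f.comp C)) := by
  rw [detPoly, RingHom.map_det]
  congr 1
  ext a b
  simp [Matrix.sum_apply]

lemma eval_detPoly (A : σ → Matrix n n ℂ) (z : σ → ℂ) :
    eval z (detPoly A) = Matrix.det (∑ i, z i • A i) := by
  rw [map_detPoly]
  congr 1
  ext a b
  simp [Matrix.sum_apply]

lemma exists_real_detPoly {A : σ → Matrix n n ℂ} (hA : ∀ i, (A i).IsHermitian) :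
    ∃ P : MvPolynomial σ ℝ, map (algebraMap ℝ ℂ) P = detPoly A := by
  have hconj : map (starRingEnd ℂ) (detPoly A) = detPoly A := by
    rw [map_detPoly, detPoly, ← Matrix.det_transpose]
    congr 1
    ext a b
    simp only [map_X, Matrix.transpose_apply, Matrix.sum_apply, Matrix.smul_apply,
      Matrix.map_apply, RingHom.comp_apply, map_C]
    simp only [starRingEnd_apply, (hA _).apply]
  refine mem_range_map_iff_coeffs_subset.2 fun c hc => ?_
  obtain ⟨k, -, rfl⟩ := mem_coeffs_iff.1 hc
  have := congrArg (coeff k) hconj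
  rw [coeff_map] at this
  exact ⟨_, (Complex.conj_eq_iff_re.1 this)⟩

lemma det_sum_smul_ne_zero_of_re_pos {A : σ → Matrix n n ℂ} (hA : ∀ i, (A i).PosSemidef)
    (hsum : ∑ i, A i = 1) {z : σ → ℂ} (hz : ∀ i, 0 < (z i).re) :
    Matrix.det (∑ i, z i • A i) ≠ 0 := by
  intro h0
  obtain ⟨v, hv, hv0⟩ := Matrix.exists_mulVec_eq_zero_iff.2 h0
  have hq : ∀ w : σ → ℂ, star v ⬝ᵥ ((∑ i, w i • A i).mulVec v)
      = ∑ i, w i * (star v ⬝ᵥ (A i).mulVec v) := by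
    intro w
    simp [Matrix.sum_mulVec, Matrix.smul_mulVec, dotProduct_sum]
  have hnn : ∀ i, 0 ≤ (star v ⬝ᵥ (A i).mulVec v).re ∧ (star v ⬝ᵥ (A i).mulVec v).im = 0 := by
    intro i
    have := Complex.nonneg_iff.1 ((hA i).dotProduct_mulVec_nonneg v)
    exact ⟨this.1, this.2.symm⟩
  have h1 := hq z
  rw [hv0, dotProduct_zero] at h1
  have h2 : ∑ i, (z i).re * (star v ⬝ᵥ (A i).mulVec v).re = 0 := by
    have := congrArg Complex.re h1
    simpa [Complex.re_sum, Complex.mul_re, (hnn _).2] using this.symm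
  have h3 : ∀ i, (star v ⬝ᵥ (A i).mulVec v) = 0 := by
    intro i
    have := (Finset.sum_eq_zero_iff_of_nonneg
      fun i _ => mul_nonneg (hz i).le (hnn i).1).1 h2 i (Finset.mem_univ i)
    exact Complex.ext ((mul_eq_zero.1 this).resolve_left (hz i).ne') (hnn i).2
  have h4 := hq fun _ => 1
  simp only [one_smul, hsum, Matrix.one_mulVec, h3, mul_zero, Finset.sum_const_zero] at h4
  exact hv (dotProduct_star_self_eq_zero.1 h4)

lemma det_sum_smul_ne_zero_of_im_pos {A : σ → Matrix n n ℂ} (hA : ∀ i, (A i).PosSemidef)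
    (hsum : ∑ i, A i = 1) {z : σ → ℂ} (hz : ∀ i, 0 < (z i).im) :
    Matrix.det (∑ i, z i • A i) ≠ 0 := by
  have h := det_sum_smul_ne_zero_of_re_pos hA hsum (z := fun i => -Complex.I * z i)
    fun i => by simpa using hz i
  simp only [mul_smul, ← Finset.smul_sum, Matrix.det_smul] at h
  exact right_ne_zero_of_mul h

/-- At the diagonal point `(t, …, t)` the `j`-th barrier of `det (∑ i, z_i A_i)` is
`Tr A_j / t`. -/
lemma barrier_detPoly {A : σ → Matrix n n ℂ} (hsum : ∑ i, A i = 1)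
    {P : MvPolynomial σ ℝ} (hP : map (algebraMap ℝ ℂ) P = detPoly A) {t : ℝ} (ht : t ≠ 0) (j : σ) :
    barrier P j (fun _ => t) = (A j).trace.re / t := by
  classical
  have hval : ∀ z : σ → ℂ, aeval z P = Matrix.det (∑ i, z i • A i) := fun z => by
    rw [← eval_detPoly, ← hP, eval_map, aeval_def]
  have ht' : (t : ℂ) ≠ 0 := by exact_mod_cast ht
  set g : Polynomial ℂ := Matrix.det (1 + (Polynomial.X : Polynomial ℂ) • (A j).map Polynomial.C)
    with hg
  have hline : linePoly P (fun _ => (t : ℂ)) (Pi.single j 1)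
      = Polynomial.C ((t : ℂ) ^ Fintype.card n) *
        g.comp (Polynomial.C (t : ℂ)⁻¹ * Polynomial.X) := by
    refine Polynomial.funext fun u => ?_
    rw [eval_linePoly, hval]
    simp only [Polynomial.eval_mul, Polynomial.eval_C, Polynomial.eval_comp, Polynomial.eval_X, hg]
    rw [← Polynomial.coe_evalRingHom, RingHom.map_det, ← Matrix.det_smul]
    congr 1
    have : ∑ i, ((t : ℂ) + (Pi.single j 1 : σ → ℂ) i * u) • A i = (t : ℂ) • 1 + u • A j := by
      simp only [add_smul, Finset.sum_add_distrib, ← Finset.smul_sum, hsum]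
      congr 1
      rw [Finset.sum_eq_single j]
      · simp
      · intro i _ hi; simp [hi]
      · simp
    rw [this]
    ext a b
    by_cases hab : a = b
    · subst hab; simp; field_simp
    · simp [hab]; field_simp
  have hder : aeval (fun _ => (t : ℂ)) (pderiv j P)
      = (t : ℂ) ^ Fintype.card n * ((t : ℂ)⁻¹ * (A j).trace) := by
    have h1 := congrArg (fun q => (Polynomial.derivative q).eval 0) hline
    simp only [derivative_linePoly, eval_linePoly, mul_zero, add_zero, Polynomial.derivative_C_mul,
      Polynomial.derivative_comp, Polynomial.eval_mul, Polynomial.eval_C, Polynomial.eval_comp,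
      Polynomial.eval_X, Polynomial.derivative_X, mul_one] at h1
    rw [h1, hg, Matrix.derivative_det_one_add_X_smul]
  have hzero : aeval (fun _ => (t : ℂ)) P = (t : ℂ) ^ Fintype.card n := by
    rw [hval, ← Finset.smul_sum, hsum, Matrix.det_smul, Matrix.det_one, mul_one]
  have hfin : ((barrier P j (fun _ => t) : ℝ) : ℂ) = (A j).trace / t := by
    rw [barrier, Complex.ofReal_div, ← aeval_ofReal, ← aeval_ofReal, hder, hzero]
    field_simp
  have := congrArg Complex.re hfin
  rwa [Complex.ofReal_re, Complex.div_ofReal_re] at this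

end Determinant

section MixedCharPoly

lemma map_applyOneSubPderiv {σ R S : Type*} [CommRing R] [CommRing S] (f : R →+* S) (l : List σ)
    (p : MvPolynomial σ R) :
    map f (applyOneSubPderiv l p) = applyOneSubPderiv l (map f p) := by
  induction l with
  | nil => rfl
  | cons i l ih =>
    change map f (applyOneSubPderiv l p - pderiv i (applyOneSubPderiv l p)) = _
    rw [map_sub, ← pderiv_map, ih]
    rfl

/-- The substitution `z_i ↦ z + z_i`. -/
noncomputable def shiftHom (m : ℕ) : MvPolynomial (Fin m) ℂ →ₐ[ℂ] MvPolynomial (Fin (m + 1)) ℂ :=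
  aeval fun i => X 0 + X i.succ

lemma pderiv_shiftHom {m : ℕ} (i : Fin m) (p : MvPolynomial (Fin m) ℂ) :
    pderiv i.succ (shiftHom m p) = shiftHom m (pderiv i p) := by
  induction p using MvPolynomial.induction_on with
  | C a => simp [shiftHom, algebraMap_eq]
  | add p q hp hq => simp [hp, hq]
  | mul_X p k hp =>
    rw [map_mul, pderiv_mul, pderiv_mul, hp, map_add, map_mul, map_mul]
    congr 2
    by_cases hk : k = i
    · subst hk; simp [shiftHom, pderiv_X]
    · simp [shiftHom, pderiv_X, hk]

lemma foldr_shiftHom {m : ℕ} (l : List (Fin m)) (p : MvPolynomial (Fin m) ℂ) :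
    l.foldr (fun i q => q - pderiv i.succ q) (shiftHom m p)
      = shiftHom m (applyOneSubPderiv l p) := by
  induction l with
  | nil => rfl
  | cons i l ih =>
    rw [List.foldr_cons, ih, pderiv_shiftHom, ← map_sub]
    rfl

/-- When the matrices sum to the identity, the mixed characteristic polynomial is the diagonal
restriction of `∏ (1 - ∂ᵢ) det (∑ i, z_i A_i)`. -/
lemma eval_mixedCharPoly {d m : ℕ} {A : Fin m → Matrix (Fin d) (Fin d) ℂ} (hsum : ∑ i, A i = 1)
    (x : ℂ) : (mixedCharPoly A).eval x
      = eval (fun _ => x) (applyOneSubPderiv (List.finRange m) (detPoly A)) := by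
  have hdet : Matrix.det ((X (0 : Fin (m + 1)) : MvPolynomial (Fin (m + 1)) ℂ) •
        (1 : Matrix (Fin d) (Fin d) (MvPolynomial (Fin (m + 1)) ℂ)) +
      ∑ i : Fin m, (X i.succ : MvPolynomial (Fin (m + 1)) ℂ) • (A i).map C)
      = shiftHom m (detPoly A) := by
    have hone : (1 : Matrix (Fin d) (Fin d) (MvPolynomial (Fin (m + 1)) ℂ))
        = ∑ i, (A i).map C := by
      rw [← Matrix.map_one (C : ℂ →+* MvPolynomial (Fin (m + 1)) ℂ) (map_zero _) (map_one _),
        ← hsum]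
      ext a b : 2
      simp [Matrix.sum_apply]
    have := map_detPoly A (shiftHom m : MvPolynomial (Fin m) ℂ →+* MvPolynomial (Fin (m + 1)) ℂ)
    rw [RingHom.coe_coe] at this
    rw [this, hone, Finset.smul_sum, ← Finset.sum_add_distrib]
    congr 1
    refine Finset.sum_congr rfl fun i _ => ?_
    rw [← add_smul]
    congr 1
    · simp [shiftHom]
    · ext a b : 2
      simp [shiftHom, algebraMap_eq]
  rw [mixedCharPoly, hdet, foldr_shiftHom]
  generalize applyOneSubPderiv (List.finRange m) (detPoly A) = q
  induction q using MvPolynomial.induction_on with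
  | C a => simp [shiftHom, algebraMap_eq]
  | add p q hp hq => simp [hp, hq]
  | mul_X p k hp =>
    rw [map_mul, eval₂_mul, Polynomial.eval_mul, hp]
    simp [shiftHom]

end MixedCharPoly

/-- If `A₁, …, A_m ∈ M_d(ℂ)` are positive semidefinite with `∑ i, A i = I_d` and
`Tr A_i ≤ ε` for every `i`, then every root of the mixed characteristic polynomial
`μ[A₁, …, A_m]` is strictly smaller than `(1 + √ε)²`. -/
theorem mixedCharPoly_roots_lt (d m : ℕ) (ε : ℝ) (hε : 0 < ε)
    (A : Fin m → Matrix (Fin d) (Fin d) ℂ)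
    (hA : ∀ i, (A i).PosSemidef)
    (hsum : ∑ i, A i = 1)
    (htr : ∀ i, (A i).trace.re ≤ ε) :
    ∀ x : ℝ, (mixedCharPoly A).eval (x : ℂ) = 0 → x < (1 + Real.sqrt ε) ^ 2 := by
  intro x hx
  by_contra! hle
  obtain ⟨P, hP⟩ := exists_real_detPoly fun i => (hA i).1
  have hval : ∀ z : Fin m → ℂ, aeval z P = Matrix.det (∑ i, z i • A i) := fun z => by
    rw [← eval_detPoly, ← hP, eval_map, aeval_def]
  set r := Real.sqrt ε
  have hr : 0 < r := Real.sqrt_pos.2 hε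
  have hr2 : ε = r * r := (Real.mul_self_sqrt hε.le).symm
  have ht : 0 < r + ε := by positivity
  have hstable : IsStable P := fun z hz => by
    rw [hval]; exact det_sum_smul_ne_zero_of_im_pos hA hsum hz
  have habove : IsAboveRoots P (fun _ => r + ε) := fun y hy h0 => by
    refine det_sum_smul_ne_zero_of_re_pos hA hsum (z := fun i => (y i : ℂ))
      (fun i => by simpa using ht.trans_le (hy i)) ?_
    rw [← hval, aeval_ofReal, h0, Complex.ofReal_zero]
  have hbarrier : ∀ j, barrier P j (fun _ => r + ε) ≤ 1 - (1 + r)⁻¹ := fun j => by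
    rw [barrier_detPoly hsum hP ht.ne' j, div_le_iff₀ ht]
    refine (htr j).trans (le_of_eq ?_)
    rw [hr2]; field_simp; ring
  obtain ⟨-, h, -⟩ := hstable.isAboveRoots_applyOneSubPderiv habove (by positivity : 0 < 1 + r)
    hbarrier (List.finRange m) (List.nodup_finRange m)
  refine h (fun _ => x) (fun k => ?_) ?_
  · simp only [Pi.add_apply, List.mem_finRange, if_true]
    nlinarith
  · rw [eval_mixedCharPoly hsum, ← hP, ← map_applyOneSubPderiv, eval_map, ← aeval_def,
      aeval_ofReal _ (fun _ => x)] at hx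
    exact_mod_cast hx
end

section
/- Let A_1, ..., A_m ∈ M_d(ℂ) be matrices of rank one and let A = A_1 + ... + A_m. Then the characteristic polynomial of A equals the mixed characteristic polynomial of A_1, ..., A_m: p_A(z) = μ[A_1, ..., A_m](z). -/
open MvPolynomial

namespace Matrix

/-- The determinant is affine along the line spanned by an outer product. -/
theorem det_add_smul_vecMulVec {n R : Type*} [Fintype n] [DecidableEq n] [CommRing R]
    (N : Matrix n n R) (u v : n → R) (t : R) :
    (N + t • vecMulVec u v).det =
      N.det + t * ((N + vecMulVec u v).det - N.det) := by
  let M : Matrix (n ⊕ Unit) (n ⊕ Unit) R := fromBlocks N 0 (replicateRow Unit v) 1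
  have key (s : R) : (N + s • vecMulVec u v).det =
      (M.updateCol (Sum.inr ()) (Sum.elim (-(s • u)) 1)).det := by
    have hblocks : M.updateCol (Sum.inr ()) (Sum.elim (-(s • u)) 1) =
        fromBlocks N (-(s • replicateCol Unit u)) (replicateRow Unit v) 1 := by
      ext (i | i) (j | j) <;> simp [M]
    rw [hblocks, det_fromBlocks_one₂₂, vecMulVec_eq Unit, Matrix.neg_mul, sub_neg_eq_add,
      Matrix.smul_mul]
  have hcol : (Sum.elim (-(t • u)) 1 : n ⊕ Unit → R) =
      t • Sum.elim (-((1 : R) • u)) 1 + (1 - t) • Sum.elim (-((0 : R) • u)) 1 := by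
    ext (i | i) <;> simp
  have h0 := key 0
  have h1 := key 1
  rw [key t, hcol, det_updateCol_add, det_updateCol_smul, det_updateCol_smul, ← h0, ← h1,
    zero_smul, add_zero, one_smul]
  ring

theorem exists_eq_vecMulVec_of_rank_eq_one {m n K : Type*} [Fintype n] [DecidableEq n] [Field K]
    {A : Matrix m n K} (hA : A.rank = 1) : ∃ u v, A = vecMulVec u v := by
  obtain ⟨u, -, hu⟩ := finrank_eq_one_iff'.mp hA
  choose c hc using fun j => hu ⟨A *ᵥ Pi.single j 1, ⟨Pi.single j 1, rfl⟩⟩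
  refine ⟨u, c, ?_⟩
  ext i j
  have h := congrFun (congrArg Subtype.val (hc j)) i
  simp only [SetLike.val_smul, Pi.smul_apply, smul_eq_mul, mulVec_single_one, col_apply] at h
  rw [vecMulVec_apply, ← h, mul_comm]

theorem det_mem_subalgebra {n R S : Type*} [Fintype n] [DecidableEq n] [CommRing R] [CommRing S]
    [Algebra R S] (T : Subalgebra R S) {N : Matrix n n S} (hN : ∀ i j, N i j ∈ T) :
    N.det ∈ T := by
  rw [det_apply]
  exact sum_mem fun σ _ => zsmul_mem (prod_mem fun i _ => hN _ _) _

end Matrix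

namespace MvPolynomial

open Matrix

theorem pderiv_eq_zero_of_mem_supported_compl {σ R : Type*} [CommRing R] {k : σ}
    {p : MvPolynomial σ R} (hp : p ∈ supported R ({k}ᶜ : Set σ)) : pderiv k p = 0 :=
  pderiv_eq_zero_of_notMem_vars fun hk => mem_supported.mp hp hk rfl

/-- On a determinant that varies with `X k` along a constant outer product, `1 - ∂ₖ` acts as the
shift `X k ↦ X k - 1`. -/
theorem det_sub_pderiv_det {σ n R : Type*} [Fintype n] [DecidableEq n] [CommRing R] {k : σ}
    {N : Matrix n n (MvPolynomial σ R)} (hN : ∀ i j, N i j ∈ supported R ({k}ᶜ : Set σ))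
    (u v : n → R) :
    (N + (X k : MvPolynomial σ R) • (vecMulVec u v).map C).det -
        pderiv k (N + (X k : MvPolynomial σ R) • (vecMulVec u v).map C).det =
      (N + (X k - 1 : MvPolynomial σ R) • (vecMulVec u v).map C).det := by
  have hmap : (vecMulVec u v).map (C : R → MvPolynomial σ R) =
      vecMulVec (fun i => C (u i)) (fun j => C (v j)) := by
    ext1 i j
    simp [vecMulVec_apply]
  have hdet : pderiv k N.det = 0 :=
    pderiv_eq_zero_of_mem_supported_compl (det_mem_subalgebra _ hN)
  have hdet' : pderiv k (N + vecMulVec (fun i => C (u i)) (fun j => C (v j))).det = 0 :=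
    pderiv_eq_zero_of_mem_supported_compl <| det_mem_subalgebra _ fun i j =>
      add_mem (hN i j) (mul_mem (Subalgebra.algebraMap_mem _ _) (Subalgebra.algebraMap_mem _ _))
  rw [hmap, det_add_smul_vecMulVec, det_add_smul_vecMulVec N _ _ (X k - 1), map_add,
    Derivation.leibniz, map_sub, hdet, hdet', pderiv_X_self]
  simp only [smul_eq_mul]
  ring

theorem foldr_sub_pderiv_det {d m : ℕ} (A : Fin m → Matrix (Fin d) (Fin d) ℂ)
    (hrank : ∀ i, (A i).rank = 1) (l : List (Fin m)) (hl : l.Nodup) :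
    l.foldr (fun i q => q - pderiv i.succ q)
        ((X (0 : Fin (m + 1)) : MvPolynomial (Fin (m + 1)) ℂ) • 1 +
          ∑ i : Fin m, (X i.succ : MvPolynomial (Fin (m + 1)) ℂ) • (A i).map C).det =
      ((X (0 : Fin (m + 1)) : MvPolynomial (Fin (m + 1)) ℂ) • 1 +
        ∑ i : Fin m, (X i.succ - if i ∈ l then 1 else 0 : MvPolynomial (Fin (m + 1)) ℂ) •
          (A i).map C).det := by
  induction l with
  | nil => simp
  | cons k l ih =>
    obtain ⟨hk, hl⟩ := List.nodup_cons.mp hl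
    obtain ⟨u, v, huv⟩ := exists_eq_vecMulVec_of_rank_eq_one (hrank k)
    rw [List.foldr_cons, ih hl]
    let N : Matrix (Fin d) (Fin d) (MvPolynomial (Fin (m + 1)) ℂ) :=
      (X 0 : MvPolynomial (Fin (m + 1)) ℂ) • 1 + ∑ i ∈ Finset.univ.erase k,
        (X i.succ - if i ∈ l then 1 else 0 : MvPolynomial (Fin (m + 1)) ℂ) • (A i).map C
    have hN (a b) : N a b ∈ supported ℂ ({k.succ}ᶜ : Set (Fin (m + 1))) := by
      simp only [N, Matrix.add_apply, Matrix.sum_apply, Matrix.smul_apply, smul_eq_mul,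
        Matrix.map_apply, Matrix.one_apply]
      refine add_mem (mul_mem (X_mem_supported.mpr (Fin.succ_ne_zero k).symm) ?_) <|
        sum_mem fun i hi => mul_mem (sub_mem (X_mem_supported.mpr ?_) ?_)
          (Subalgebra.algebraMap_mem _ _)
      · split_ifs
        exacts [one_mem _, zero_mem _]
      · simpa using Finset.ne_of_mem_erase hi
      · split_ifs
        exacts [one_mem _, zero_mem _]
    have hsplit := det_sub_pderiv_det hN u v
    rw [← huv] at hsplit
    convert hsplit using 2
    · rw [← Finset.sum_erase_add _ _ (Finset.mem_univ k), ← add_assoc, if_neg hk, sub_zero]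
    · rw [← Finset.sum_erase_add _ _ (Finset.mem_univ k), ← add_assoc, if_neg hk, sub_zero]
    · rw [← Finset.sum_erase_add _ _ (Finset.mem_univ k), ← add_assoc,
        if_pos List.mem_cons_self]
      congr 2
      refine Finset.sum_congr rfl fun i hi => ?_
      simp [List.mem_cons, Finset.ne_of_mem_erase hi]

end MvPolynomial

/-- If `A₁, …, A_m ∈ M_d(ℂ)` are rank-one matrices and `A = A₁ + ⋯ + A_m`, then the
characteristic polynomial of `A` coincides with the mixed characteristic polynomial:
`p_A(z) = μ[A₁, …, A_m](z)`. -/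
theorem charpoly_eq_mixedCharPoly (d m : ℕ) (A : Fin m → Matrix (Fin d) (Fin d) ℂ)
    (hrank : ∀ i, (A i).rank = 1) :
    Matrix.charpoly (∑ i, A i) = mixedCharPoly A := by
  rw [mixedCharPoly, foldr_sub_pderiv_det A hrank _ (List.nodup_finRange m), ← coe_eval₂Hom,
    RingHom.map_det, Matrix.charpoly]
  congr 1
  ext1 a b
  simp [Matrix.charmatrix_apply, Matrix.sum_apply, Matrix.one_apply, Matrix.diagonal_apply,
    sub_eq_add_neg, apply_ite]
end

section
/- Let (Ω, p) be a finite probability space and let A_1(ω), ..., A_m(ω) be independent random matrices in M_d(ℂ), each of rank one for every ω ∈ Ω, and let A = A_1 + ... + A_m. Then the expected characteristic polynomial of A equals the mixed characteristic polynomial of the expectations: E(p_A) = μ[E(A_1), ..., E(A_m)], where E(p_A) is the polynomial whose coefficients are the expectations of the corresponding coefficients of p_{A(ω)}. -/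
open MvPolynomial
open scoped Classical

/-- A finite family of random matrices on a finite probability space `(Ω, pr)` is
*independent* if the joint distribution of the family is the product of the marginal
distributions. -/
def IndepMatrices {d m : ℕ} {Ω : Type*} [Fintype Ω] (pr : Ω → ℝ)
    (A : Fin m → Ω → Matrix (Fin d) (Fin d) ℂ) : Prop :=
  ∀ B : Fin m → Matrix (Fin d) (Fin d) ℂ,
    (∑ ω, if ∀ i, A i ω = B i then pr ω else 0)
      = ∏ i, ∑ ω, if A i ω = B i then pr ω else 0

namespace MixedCharPoly

section DifferentialOperator

variable {σ R : Type*} [CommRing R]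

/-- The differential operator `∏ i ∈ l, (1 - ∂_i)` on multivariate polynomials. -/
noncomputable def mixedDiff (l : List σ) : MvPolynomial σ R →ₗ[R] MvPolynomial σ R :=
  l.foldr (fun i D => (LinearMap.id - (pderiv i).toLinearMap) ∘ₗ D) LinearMap.id

theorem mixedDiff_nil (q : MvPolynomial σ R) : mixedDiff [] q = q := rfl

theorem mixedDiff_cons (i : σ) (l : List σ) (q : MvPolynomial σ R) :
    mixedDiff (i :: l) q = mixedDiff l q - pderiv i (mixedDiff l q) := rfl

theorem mixedDiff_eq_foldr (l : List σ) (q : MvPolynomial σ R) :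
    mixedDiff l q = l.foldr (fun i q => q - pderiv i q) q := by
  induction l with
  | nil => rfl
  | cons i l ih => rw [mixedDiff_cons, ih, List.foldr_cons]

theorem pderiv_comm (i j : σ) (q : MvPolynomial σ R) :
    pderiv i (pderiv j q) = pderiv j (pderiv i q) := by
  induction q using MvPolynomial.induction_on with
  | C a => simp
  | add p q hp hq => simp [hp, hq]
  | mul_X p k hp =>
    simp only [pderiv_mul, map_add, hp, pderiv_X, Pi.single_apply]
    split_ifs <;> simp [add_comm, add_left_comm]

theorem mixedDiff_pderiv (l : List σ) (i : σ) (q : MvPolynomial σ R) :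
    mixedDiff l (pderiv i q) = pderiv i (mixedDiff l q) := by
  induction l with
  | nil => rfl
  | cons j l ih => simp only [mixedDiff_cons, ih, map_sub, pderiv_comm i j]

theorem mixedDiff_of_pderiv_eq_zero (l : List σ) (q : MvPolynomial σ R)
    (h : ∀ i ∈ l, pderiv i q = 0) : mixedDiff l q = q := by
  induction l with
  | nil => rfl
  | cons j l ih =>
    rw [mixedDiff_cons, ih fun i hi => h i (List.mem_cons_of_mem _ hi),
      h j List.mem_cons_self, sub_zero]

theorem mixedDiff_X_mul {l : List σ} {i : σ} (hi : i ∉ l) (q : MvPolynomial σ R) :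
    mixedDiff l (X i * q) = X i * mixedDiff l q := by
  induction l with
  | nil => rfl
  | cons j l ih =>
    rw [List.mem_cons, not_or] at hi
    rw [mixedDiff_cons, ih hi.2, mixedDiff_cons, pderiv_mul, pderiv_X_of_ne hi.1]
    ring

theorem X_dvd_mixedDiff_X_sq_mul {l : List σ} (hl : l.Nodup) {i : σ} (q : MvPolynomial σ R) :
    X i ∣ mixedDiff l (X i ^ 2 * q) := by
  induction l with
  | nil => exact ⟨X i * q, by rw [mixedDiff_nil]; ring⟩
  | cons j l ih =>
    rw [List.nodup_cons] at hl
    rw [mixedDiff_cons]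
    by_cases hji : j = i
    · subst hji
      rw [pow_two, mul_assoc, mixedDiff_X_mul hl.1, mixedDiff_X_mul hl.1]
      refine ⟨X j * mixedDiff l q - 2 * mixedDiff l q - X j * pderiv j (mixedDiff l q), ?_⟩
      simp only [pderiv_mul, pderiv_X_self]
      ring
    · obtain ⟨s, hs⟩ := ih hl.2
      refine ⟨s - pderiv j s, ?_⟩
      rw [hs, pderiv_mul, pderiv_X_of_ne (Ne.symm hji)]
      ring

theorem X_dvd_mixedDiff_X_mul_add {l : List σ} (hl : l.Nodup) {i : σ} (hi : i ∈ l)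
    {q : MvPolynomial σ R} (hq : pderiv i q = 0) :
    X i ∣ mixedDiff l (X i * q) + mixedDiff l q := by
  induction l with
  | nil => simp at hi
  | cons j l ih =>
    rw [List.nodup_cons] at hl
    rw [mixedDiff_cons, mixedDiff_cons]
    by_cases hji : j = i
    · subst hji
      refine ⟨mixedDiff l q, ?_⟩
      have h0 : pderiv j (mixedDiff l q) = 0 := by rw [← mixedDiff_pderiv, hq, map_zero]
      rw [mixedDiff_X_mul hl.1, pderiv_mul, pderiv_X_self, h0]
      ring
    · obtain ⟨s, hs⟩ := ih hl.2 ((List.mem_cons.1 hi).resolve_left (Ne.symm hji))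
      refine ⟨s - pderiv j s, ?_⟩
      have h1 := congrArg (pderiv j) hs
      rw [pderiv_mul, pderiv_X_of_ne (Ne.symm hji), map_add] at h1
      linear_combination hs - h1

/-- Under `∏ (1 - ∂_j)` followed by evaluation at `X i = 0`, a polynomial may be truncated at
order two in `X i`, and `X i` then replaced by `-1`. -/
theorem map_mixedDiff_quadratic {S : Type*} [CommRing S] (φ : MvPolynomial σ R →+* S)
    {l : List σ} (hl : l.Nodup) {i : σ} (hi : i ∈ l) (hφ : φ (X i) = 0)
    (a r : MvPolynomial σ R) {b : MvPolynomial σ R} (hb : pderiv i b = 0) :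
    φ (mixedDiff l (a + X i * b + X i ^ 2 * r)) = φ (mixedDiff l a) - φ (mixedDiff l b) := by
  obtain ⟨s, hs⟩ := X_dvd_mixedDiff_X_sq_mul hl (i := i) r
  obtain ⟨t, ht⟩ := X_dvd_mixedDiff_X_mul_add hl hi hb
  have h := congrArg φ ht
  rw [map_add, map_mul φ, hφ, zero_mul] at h
  simp only [map_add, hs, map_mul, hφ, zero_mul, add_zero]
  linear_combination h

end DifferentialOperator

section Determinant

variable {n R : Type*} [Fintype n] [DecidableEq n] [CommRing R]

/-- The derivative of the determinant at `M` in the direction `N`. -/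
def detDeriv (M N : Matrix n n R) : R :=
  ∑ k, (M.updateRow k (N k)).det

/-- The matrix obtained from `M` by replacing its rows in `s` by those of `N`. -/
def replaceRows (s : Finset n) (N M : Matrix n n R) : Matrix n n R :=
  Matrix.of fun i j => if i ∈ s then N i j else M i j

theorem det_replaceRows_smul (s : Finset n) (N M : Matrix n n R) (z : R) :
    (replaceRows s (z • N) M).det = z ^ s.card * (replaceRows s N M).det := by
  have h := Matrix.detRowAlternating.toMultilinearMap.map_piecewise_smul
    (fun _ : n => z) (fun i => replaceRows s N M i) s
  rw [Finset.prod_const] at h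
  refine Eq.trans (congrArg Matrix.det ?_) h
  ext i j
  by_cases hi : i ∈ s <;> simp [replaceRows, Finset.piecewise, hi]

theorem det_add_eq_sum_replaceRows (N M : Matrix n n R) :
    (N + M).det = ∑ s : Finset n, (replaceRows s N M).det := by
  refine (Matrix.detRowAlternating.toMultilinearMap.map_add_univ (fun i => N i)
    fun i => M i).trans (Finset.sum_congr rfl fun s _ => congrArg Matrix.det ?_)
  ext i j
  by_cases hi : i ∈ s <;> simp [replaceRows, Finset.piecewise, hi]

theorem det_add_smul_expand (M N : Matrix n n R) (z : R) :
    (M + z • N).det = M.det + z * detDeriv M N +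
      ∑ s : Finset n with 2 ≤ s.card, z ^ s.card * (replaceRows s N M).det := by
  have h : ∑ s : Finset n with ¬ 2 ≤ s.card, z ^ s.card * (replaceRows s N M).det =
      M.det + z * detDeriv M N := by
    have e : (Finset.univ.filter fun s : Finset n => ¬ 2 ≤ s.card) =
        insert ∅ (Finset.univ.image fun k : n => ({k} : Finset n)) := by
      ext s
      simp only [Finset.mem_filter, Finset.mem_univ, true_and, Finset.mem_insert,
        Finset.mem_image]
      rw [show ¬ 2 ≤ s.card ↔ s.card = 0 ∨ s.card = 1 by lia, Finset.card_eq_zero,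
        Finset.card_eq_one]
      simp [eq_comm]
    have h0 : replaceRows ∅ N M = M := by
      ext i j
      simp [replaceRows]
    have h1 (k : n) : replaceRows {k} N M = M.updateRow k (N k) := by
      ext i j
      by_cases hi : i = k
      · subst hi
        simp [replaceRows]
      · simp [replaceRows, hi]
    rw [e, Finset.sum_insert (by simp),
      Finset.sum_image fun _ _ _ _ hab => Finset.singleton_injective hab, detDeriv,
      Finset.mul_sum]
    simp [h0, h1]
  rw [← h, add_comm M, det_add_eq_sum_replaceRows, add_comm, Finset.sum_filter_add_sum_filter_not]
  exact Finset.sum_congr rfl fun s _ => det_replaceRows_smul s N M z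

theorem exists_det_add_smul_eq (M N : Matrix n n R) (z : R) :
    ∃ r, (M + z • N).det = M.det + z * detDeriv M N + z ^ 2 * r := by
  refine ⟨∑ s : Finset n with 2 ≤ s.card, z ^ (s.card - 2) * (replaceRows s N M).det, ?_⟩
  rw [det_add_smul_expand, Finset.mul_sum]
  congr 1
  refine Finset.sum_congr rfl fun s hs => ?_
  rw [← mul_assoc, ← pow_add, Nat.add_sub_cancel' (Finset.mem_filter.1 hs).2]

theorem det_add_smul_vecMulVec (M : Matrix n n R) (u v : n → R) (z : R) :
    (M + z • Matrix.vecMulVec u v).det = M.det + z * detDeriv M (Matrix.vecMulVec u v) := by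
  rw [det_add_smul_expand, add_eq_left]
  refine Finset.sum_eq_zero fun s hs => ?_
  obtain ⟨a, ha, b, hb, hab⟩ := Finset.one_lt_card.1 (Finset.mem_filter.1 hs).2
  set K := replaceRows s (Matrix.vecMulVec u v) M with hK
  have hKab : K = ((K.updateRow a v).updateRow b (u b • v)).updateRow a (u a • v) := by
    ext i j
    by_cases hia : i = a
    · subst hia
      simp [hK, replaceRows, ha, Matrix.vecMulVec_apply]
    · by_cases hib : i = b
      · subst hib
        simp [hK, replaceRows, hb, hia, Matrix.vecMulVec_apply]
      · simp [hia, hib]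
  have h0 : (((K.updateRow a v).updateRow b (u b • v)).updateRow a v).det = 0 := by
    rw [Matrix.updateRow_comm _ hab.symm, Matrix.det_updateRow_smul,
      Matrix.det_zero_of_row_eq hab, mul_zero]
    rw [Matrix.updateRow_ne hab, Matrix.updateRow_self, Matrix.updateRow_self]
  rw [hKab, Matrix.det_updateRow_smul, h0, mul_zero, mul_zero]

theorem detDeriv_sum {ι : Type*} (s : Finset ι) (M : Matrix n n R) (c : ι → R)
    (N : ι → Matrix n n R) :
    detDeriv M (∑ j ∈ s, c j • N j) = ∑ j ∈ s, c j * detDeriv M (N j) := by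
  simp only [detDeriv, Finset.mul_sum]
  rw [Finset.sum_comm]
  refine Finset.sum_congr rfl fun k _ => ?_
  have h := map_sum (Matrix.detRowAlternating.toMultilinearMap.toLinearMap (fun i => M i) k)
    (fun j => c j • N j k) s
  have e : (∑ j ∈ s, c j • N j).row k = ∑ j ∈ s, c j • N j k := by
    ext l
    simp [Matrix.sum_apply, Finset.sum_apply]
  refine (congrArg (fun t => (M.updateRow k t).det) e).trans
    (h.trans (Finset.sum_congr rfl fun j _ => ?_))
  exact Matrix.det_updateRow_smul M k (c j) (N j k)

theorem derivation_det_eq_zero {S : Type*} [CommRing S] [Algebra S R] (D : Derivation S R R)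
    {M : Matrix n n R} (hM : ∀ i j, D (M i j) = 0) : D M.det = 0 := by
  rw [Matrix.det_apply', map_sum]
  refine Finset.sum_eq_zero fun τ _ => ?_
  have h : D (∏ i, M (τ i) i) = 0 := by
    refine Finset.prod_induction _ (fun x => D x = 0) (fun a b ha hb => ?_) (by simp)
      fun i _ => hM _ _
    rw [D.leibniz, ha, hb]
    simp
  rw [D.leibniz, h, D.map_intCast]
  simp

theorem derivation_detDeriv_eq_zero {S : Type*} [CommRing S] [Algebra S R]
    (D : Derivation S R R) {M N : Matrix n n R} (hM : ∀ i j, D (M i j) = 0)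
    (hN : ∀ i j, D (N i j) = 0) : D (detDeriv M N) = 0 := by
  rw [detDeriv, map_sum]
  refine Finset.sum_eq_zero fun k _ => derivation_det_eq_zero D fun i j => ?_
  rw [Matrix.updateRow_apply]
  split_ifs
  exacts [hN _ _, hM _ _]

theorem exists_eq_vecMulVec_of_rank_eq_one {n K : Type*} [Fintype n] [Field K]
    {A : Matrix n n K}
    (hA : A.rank = 1) : ∃ u v : n → K, A = Matrix.vecMulVec u v := by
  rw [Matrix.rank_eq_finrank_span_row] at hA
  obtain ⟨v, hv⟩ := finrank_le_one_iff.1 hA.le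
  choose u hu using fun i => hv ⟨A i, Submodule.subset_span ⟨i, rfl⟩⟩
  refine ⟨u, v, ?_⟩
  ext i j
  have h := congrFun (congrArg Subtype.val (hu i)) j
  simpa [Matrix.vecMulVec_apply] using h.symm

end Determinant

section MixedCharPoly

variable {d m : ℕ}

/-- The evaluation `z ↦ X`, `z_i ↦ 0` in the definition of the mixed characteristic polynomial. -/
noncomputable def evalAtZero (m : ℕ) : MvPolynomial (Fin (m + 1)) ℂ →ₐ[ℂ] Polynomial ℂ :=
  aeval (Fin.cases Polynomial.X (fun _ : Fin m => 0))

/-- The functional `q ↦ (∏ i, (1 - ∂_i)) q` evaluated at `z₁ = ⋯ = z_m = 0`. -/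
noncomputable def mixedEval (m : ℕ) : MvPolynomial (Fin (m + 1)) ℂ →ₗ[ℂ] Polynomial ℂ :=
  (evalAtZero m).toLinearMap ∘ₗ mixedDiff ((List.finRange m).map Fin.succ)

/-- The matrix `z I + ∑ i, c_i A_i` with polynomial coefficients `c_i`. -/
noncomputable def pencil (c : Fin m → MvPolynomial (Fin (m + 1)) ℂ)
    (A : Fin m → Matrix (Fin d) (Fin d) ℂ) :
    Matrix (Fin d) (Fin d) (MvPolynomial (Fin (m + 1)) ℂ) :=
  (X 0 : MvPolynomial (Fin (m + 1)) ℂ) • 1 + ∑ i, c i • (A i).map C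

theorem mixedCharPoly_eq_mixedEval (A : Fin m → Matrix (Fin d) (Fin d) ℂ) :
    mixedCharPoly A = mixedEval m (pencil (fun i => X i.succ) A).det := by
  simp only [mixedEval, LinearMap.comp_apply, mixedDiff_eq_foldr, List.foldr_map]
  rfl

theorem mixedEval_quadratic (i : Fin m) (a r : MvPolynomial (Fin (m + 1)) ℂ)
    {b : MvPolynomial (Fin (m + 1)) ℂ} (hb : pderiv i.succ b = 0) :
    mixedEval m (a + X i.succ * b + X i.succ ^ 2 * r) = mixedEval m a - mixedEval m b :=
  map_mixedDiff_quadratic (evalAtZero m).toRingHom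
    ((List.nodup_finRange m).map (Fin.succ_injective m))
    (List.mem_map_of_mem (List.mem_finRange i)) (by simp [evalAtZero]) a r hb

theorem pencil_eq_add (c : Fin m → MvPolynomial (Fin (m + 1)) ℂ)
    (A : Fin m → Matrix (Fin d) (Fin d) ℂ) (i : Fin m) :
    pencil c A = pencil (Function.update c i 0) A + c i • (A i).map C := by
  rw [pencil, pencil, ← Finset.add_sum_erase _ _ (Finset.mem_univ i),
    ← Finset.add_sum_erase _ _ (Finset.mem_univ i)]
  have h : ∑ j ∈ Finset.univ.erase i, Function.update c i 0 j • (A j).map (C (σ := Fin (m + 1))) =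
      ∑ j ∈ Finset.univ.erase i, c j • (A j).map C :=
    Finset.sum_congr rfl fun j hj => by rw [Function.update_of_ne (Finset.ne_of_mem_erase hj)]
  rw [h, Function.update_self, zero_smul]
  abel

theorem pderiv_pencil_apply (c : Fin m → MvPolynomial (Fin (m + 1)) ℂ)
    (A : Fin m → Matrix (Fin d) (Fin d) ℂ) {i : Fin m} (hc : ∀ j, pderiv i.succ (c j) = 0)
    (k l : Fin d) : pderiv i.succ (pencil c A k l) = 0 := by
  simp only [pencil, Matrix.add_apply, Matrix.sum_apply, Matrix.smul_apply, Matrix.map_apply,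
    smul_eq_mul, map_add, map_sum, pderiv_mul, hc, pderiv_C, Matrix.one_apply,
    pderiv_X_of_ne (Fin.succ_ne_zero i).symm]
  split_ifs <;> simp

theorem pderiv_update_zero {c : Fin m → MvPolynomial (Fin (m + 1)) ℂ} {i : Fin m}
    (hc : ∀ j ≠ i, pderiv i.succ (c j) = 0) (j : Fin m) :
    pderiv i.succ (Function.update c i 0 j) = 0 := by
  by_cases hj : j = i
  · subst hj
    simp
  · rw [Function.update_of_ne hj, hc j hj]

theorem mixedEval_det_pencil {c : Fin m → MvPolynomial (Fin (m + 1)) ℂ}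
    (A : Fin m → Matrix (Fin d) (Fin d) ℂ) {i : Fin m} (hci : c i = X i.succ)
    (hc : ∀ j ≠ i, pderiv i.succ (c j) = 0) :
    mixedEval m (pencil c A).det = mixedEval m (pencil (Function.update c i 0) A).det -
      mixedEval m (detDeriv (pencil (Function.update c i 0) A) ((A i).map C)) := by
  obtain ⟨r, hr⟩ := exists_det_add_smul_eq (pencil (Function.update c i 0) A)
    ((A i).map (C (σ := Fin (m + 1)))) (X i.succ)
  rw [pencil_eq_add c A i, hci, hr]
  exact mixedEval_quadratic i _ _ (derivation_detDeriv_eq_zero _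
    (pderiv_pencil_apply _ _ (pderiv_update_zero hc)) (by simp))

theorem pencil_update_zero_update (c : Fin m → MvPolynomial (Fin (m + 1)) ℂ)
    (A : Fin m → Matrix (Fin d) (Fin d) ℂ) (i : Fin m) (B : Matrix (Fin d) (Fin d) ℂ) :
    pencil (Function.update c i 0) (Function.update A i B) =
      pencil (Function.update c i 0) A := by
  simp only [pencil]
  congr 1
  refine Finset.sum_congr rfl fun j _ => ?_
  by_cases hj : j = i
  · subst hj
    simp
  · simp [hj]

theorem mixedCharPoly_update (A : Fin m → Matrix (Fin d) (Fin d) ℂ) (i : Fin m)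
    (B : Matrix (Fin d) (Fin d) ℂ) :
    mixedCharPoly (Function.update A i B) =
      mixedEval m (pencil (Function.update (fun j => X j.succ) i 0) A).det -
        mixedEval m (detDeriv (pencil (Function.update (fun j => X j.succ) i 0) A)
          (B.map C)) := by
  rw [mixedCharPoly_eq_mixedEval, mixedEval_det_pencil (i := i) _ rfl,
    pencil_update_zero_update, Function.update_self]
  exact fun j hj => pderiv_X_of_ne ((Fin.succ_injective m).ne hj)

/-- The mixed characteristic polynomial is affine in each matrix. -/
theorem mixedCharPoly_update_sum {Ω : Type*} [Fintype Ω] {w : Ω → ℂ} (hw : ∑ ω, w ω = 1)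
    (A : Fin m → Matrix (Fin d) (Fin d) ℂ) (i : Fin m) (B : Ω → Matrix (Fin d) (Fin d) ℂ) :
    mixedCharPoly (Function.update A i (∑ ω, w ω • B ω)) =
      ∑ ω, w ω • mixedCharPoly (Function.update A i (B ω)) := by
  have h : (∑ ω, w ω • B ω).map (C (σ := Fin (m + 1))) =
      ∑ ω, (C (w ω) : MvPolynomial (Fin (m + 1)) ℂ) • (B ω).map C := by
    ext1 k l
    simp [Matrix.sum_apply]
  simp only [mixedCharPoly_update, h, detDeriv_sum, ← MvPolynomial.smul_eq_C_mul, map_sum,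
    map_smul, smul_sub, Finset.sum_sub_distrib, ← Finset.sum_smul, hw, one_smul]

theorem det_pencil_neg_one (A : Fin m → Matrix (Fin d) (Fin d) ℂ) :
    (pencil (fun _ => -1) A).det =
      Polynomial.aeval (X 0 : MvPolynomial (Fin (m + 1)) ℂ) (∑ i, A i).charpoly := by
  rw [Matrix.charpoly, AlgHom.map_det]
  congr 1
  ext1 k l
  simp only [pencil, AlgHom.mapMatrix_apply, Matrix.map_apply, Matrix.charmatrix_apply,
    Matrix.add_apply, Matrix.smul_apply, Matrix.sum_apply, Matrix.diagonal_apply,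
    Matrix.one_apply, map_sub, Polynomial.aeval_C, map_sum]
  split_ifs <;> simp [MvPolynomial.algebraMap_eq, sub_eq_add_neg]

theorem mixedEval_aeval_X_zero (p : Polynomial ℂ) :
    mixedEval m (Polynomial.aeval (X 0 : MvPolynomial (Fin (m + 1)) ℂ) p) = p := by
  rw [mixedEval, LinearMap.comp_apply, mixedDiff_of_pderiv_eq_zero]
  · rw [AlgHom.toLinearMap_apply, ← Polynomial.aeval_algHom_apply]
    simp [evalAtZero]
  · intro i hi
    obtain ⟨j, -, rfl⟩ := List.mem_map.1 hi
    rw [Derivation.map_aeval, pderiv_X_of_ne (Fin.succ_ne_zero j).symm, smul_zero]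

/-- For matrices of the form `u vᵀ`, the mixed characteristic polynomial is the characteristic
polynomial of the sum. -/
theorem mixedCharPoly_eq_charpoly_sum {A : Fin m → Matrix (Fin d) (Fin d) ℂ}
    (hA : ∀ i, ∃ u v : Fin d → ℂ, A i = Matrix.vecMulVec u v) :
    mixedCharPoly A = (∑ i, A i).charpoly := by
  have key (s : Finset (Fin m)) :
      mixedEval m (pencil (s.piecewise (fun _ => -1) fun i => X i.succ) A).det =
        mixedCharPoly A := by
    induction s using Finset.induction_on with
    | empty => rw [Finset.piecewise_empty, mixedCharPoly_eq_mixedEval]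
    | insert i s hi ih =>
      have hc (j : Fin m) (hj : j ≠ i) : pderiv i.succ
          (s.piecewise (fun _ => -1) (fun i => X i.succ) j : MvPolynomial (Fin (m + 1)) ℂ) = 0 := by
        by_cases hjs : j ∈ s
        · simp [Finset.piecewise_eq_of_mem _ _ _ hjs]
        · rw [Finset.piecewise_eq_of_notMem _ _ _ hjs,
            pderiv_X_of_ne ((Fin.succ_injective m).ne hj)]
      rw [← ih, mixedEval_det_pencil A (Finset.piecewise_eq_of_notMem _ _ _ hi) hc,
        Finset.piecewise_insert, pencil_eq_add (Function.update _ i (-1)) A i,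
        Function.update_idem, Function.update_self]
      obtain ⟨u, v, huv⟩ := hA i
      have h : (A i).map (C (σ := Fin (m + 1))) =
          Matrix.vecMulVec (fun k => C (u k)) fun k => C (v k) := by
        ext1 k l
        simp [huv, Matrix.vecMulVec_apply]
      rw [h, det_add_smul_vecMulVec, neg_one_mul, ← sub_eq_add_neg, map_sub]
  rw [← key Finset.univ, Finset.piecewise_univ, det_pencil_neg_one, mixedEval_aeval_X_zero]

end MixedCharPoly

section Expectation

/-- A function that is affine in each argument maps barycenters to the iterated average. -/
theorem map_barycenter_eq_sum {Ω V W : Type*} [Fintype Ω] [AddCommGroup V] [Module ℂ V]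
    [AddCommGroup W] [Module ℂ W] (w : Ω → ℂ) (m : ℕ) (g : (Fin m → V) → W)
    (hg : ∀ x i (y : Ω → V), g (Function.update x i (∑ ω, w ω • y ω)) =
      ∑ ω, w ω • g (Function.update x i (y ω)))
    (x : Fin m → Ω → V) :
    g (fun i => ∑ ω, w ω • x i ω) =
      ∑ r : Fin m → Ω, (∏ i, w (r i)) • g (fun i => x i (r i)) := by
  induction m with
  | zero =>
    simp only [Finset.univ_unique, Finset.sum_singleton, Finset.univ_eq_empty, Finset.prod_empty,
      one_smul]
    exact congrArg g (Subsingleton.elim _ _)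
  | succ m ih =>
    have hcons (v : V) := ih (fun y => g (Fin.cons v y))
      (fun y i z => by simp only [Fin.cons_update]; exact hg _ _ _) (fun i => x i.succ)
    have h0 (y : Fin m → V) : g (Fin.cons (∑ ω, w ω • x 0 ω) y) =
        ∑ ω, w ω • g (Fin.cons (x 0 ω) y) := by
      simpa only [Fin.update_cons_zero] using hg (Fin.cons 0 y) 0 (x 0)
    have hE : (fun i => ∑ ω, w ω • x i ω) =
        Fin.cons (∑ ω, w ω • x 0 ω) fun i : Fin m => ∑ ω, w ω • x i.succ ω := by
      ext1 i
      cases i using Fin.cases <;> simp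
    rw [hE, h0, ← (Fin.consEquiv fun _ : Fin (m + 1) => Ω).sum_comp, Fintype.sum_prod_type]
    refine Finset.sum_congr rfl fun ω _ => ?_
    rw [hcons, Finset.smul_sum]
    refine Finset.sum_congr rfl fun r _ => ?_
    rw [smul_smul, Fin.prod_univ_succ]
    congr 2
    ext1 i
    cases i using Fin.cases <;> simp

theorem IndepMatrices.sum_smul_eq {d m : ℕ} {Ω W : Type*} [Fintype Ω] [AddCommGroup W]
    [Module ℂ W] {pr : Ω → ℝ} {A : Fin m → Ω → Matrix (Fin d) (Fin d) ℂ}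
    (hA : IndepMatrices pr A) (g : (Fin m → Matrix (Fin d) (Fin d) ℂ) → W) :
    ∑ ω, (pr ω : ℂ) • g (fun i => A i ω) =
      ∑ r : Fin m → Ω, (∏ i, (pr (r i) : ℂ)) • g (fun i => A i (r i)) := by
  set S := Fintype.piFinset fun i => Finset.univ.image (A i)
  have hS (r : Fin m → Ω) : (fun i => A i (r i)) ∈ S :=
    Fintype.mem_piFinset.2 fun i => Finset.mem_image_of_mem _ (Finset.mem_univ _)
  have collapse (r : Fin m → Ω) (c : ℂ) : c • g (fun i => A i (r i)) =
      ∑ B ∈ S, (if ∀ i, A i (r i) = B i then c else 0) • g B := by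
    rw [Finset.sum_eq_single_of_mem _ (hS r)]
    · simp
    · intro B _ hB
      rw [if_neg fun h => hB (funext h).symm, zero_smul]
  have hprod (B : Fin m → Matrix (Fin d) (Fin d) ℂ) :
      ∑ ω, (if ∀ i, A i ω = B i then (pr ω : ℂ) else 0) =
        ∑ r : Fin m → Ω, if ∀ i, A i (r i) = B i then ∏ i, (pr (r i) : ℂ) else 0 := by
    have h := congrArg (fun t : ℝ => (t : ℂ)) (hA B)
    simp only [Complex.ofReal_sum, Complex.ofReal_prod, apply_ite Complex.ofReal,
      Complex.ofReal_zero] at h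
    rw [h, Finset.prod_univ_sum, Fintype.piFinset_univ]
    refine Finset.sum_congr rfl fun r _ => ?_
    split_ifs with hr
    · exact Finset.prod_congr rfl fun i _ => if_pos (hr i)
    · obtain ⟨i, hi⟩ := not_forall.1 hr
      exact Finset.prod_eq_zero (Finset.mem_univ i) (if_neg hi)
  rw [Finset.sum_congr rfl fun ω _ => collapse (fun _ => ω) (pr ω : ℂ),
    Finset.sum_congr rfl fun r _ => collapse r (∏ i, (pr (r i) : ℂ)),
    Finset.sum_comm, Finset.sum_comm (s := (Finset.univ : Finset (Fin m → Ω)))]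
  simp only [← Finset.sum_smul, hprod]

end Expectation

end MixedCharPoly

/-- For independent rank-one random matrices `A₁(ω), …, A_m(ω)` on a finite probability
space, with `A = A₁ + ⋯ + A_m`, the expected characteristic polynomial of `A` equals
the mixed characteristic polynomial of the expectations:
`E(p_A) = μ[E(A₁), …, E(A_m)]`. -/
theorem expected_charpoly_eq_mixedCharPoly (d m : ℕ) (Ω : Type*) [Fintype Ω]
    (pr : Ω → ℝ) (hpr : ∀ ω, 0 ≤ pr ω) (hsum : ∑ ω, pr ω = 1)
    (A : Fin m → Ω → Matrix (Fin d) (Fin d) ℂ)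
    (hrank : ∀ i ω, (A i ω).rank = 1)
    (hindep : IndepMatrices pr A) :
    (∑ ω, (pr ω : ℂ) • Matrix.charpoly (∑ i, A i ω))
      = mixedCharPoly (fun i => ∑ ω, (pr ω : ℂ) • A i ω) := by
  have hw : ∑ ω, (pr ω : ℂ) = 1 := by exact_mod_cast hsum
  rw [MixedCharPoly.map_barycenter_eq_sum (fun ω => (pr ω : ℂ)) m mixedCharPoly
    (MixedCharPoly.mixedCharPoly_update_sum hw), ← MixedCharPoly.IndepMatrices.sum_smul_eq hindep]
  refine Finset.sum_congr rfl fun ω _ => ?_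
  rw [MixedCharPoly.mixedCharPoly_eq_charpoly_sum fun i =>
    MixedCharPoly.exists_eq_vecMulVec_of_rank_eq_one (hrank i ω)]
end
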